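/- arXiv:math/0611321 — 2 statements merged into one kernel-verified Lean document; each statement's English description precedes it below -/
import Mathlib

section
/- Let $M_n$ be the $n \times n$ random matrix whose entries are i.i.d. random variables taking values $+1$ and $-1$ each with probability $1/2$, and let $p_n = \mathbb{P}(\det M_n = 0)$ be the probability that $M_n$ is singular. Then for every $\varepsilon > 0$ there exists $N$ such that for all $n \geq N$, $p_n \leq (3/4 + \varepsilon)^n$. -/
open Finset

/-- The signed sum `∑ ± v i`, with sign pattern `x`. -/
def signedSum {R : Type*} [Ring R] {n : ℕ} (v : Fin n → R) (x : Fin n → Bool) : R :=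
  ∑ i, if x i then v i else -v i

/-- The number of sign patterns for which the signed sum of `v` vanishes. -/
def zeroCount {R : Type*} [Ring R] [DecidableEq R] {n : ℕ} (v : Fin n → R) : ℕ :=
  #{x : Fin n → Bool | signedSum v x = 0}

/-- The cosine `cos (2πz/N)` on `ZMod N`. -/
noncomputable def zcos {N : ℕ} [NeZero N] (z : ZMod N) : ℝ := (ZMod.stdAddChar z).re

/-- The sine `sin (2πz/N)` on `ZMod N`. -/
noncomputable def zsin {N : ℕ} [NeZero N] (z : ZMod N) : ℝ := (ZMod.stdAddChar z).im

lemma addChar_map_sum {A M ι : Type*} [AddCommMonoid A] [CommMonoid M] (ψ : AddChar A M)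
    (s : Finset ι) (f : ι → A) : ψ (∑ i ∈ s, f i) = ∏ i ∈ s, ψ (f i) := by
  classical
  induction s using Finset.induction_on with
  | empty => simp
  | insert a s ha ih => rw [Finset.sum_insert ha, Finset.prod_insert ha, AddChar.map_add_eq_mul, ih]

lemma isUnit_two_of_odd {N : ℕ} (hN : Odd N) : IsUnit (2 : ZMod N) := by
  have : IsUnit ((2 : ℕ) : ZMod N) := by
    rw [ZMod.isUnit_iff_coprime]
    exact Nat.coprime_two_left.2 hN
  exact_mod_cast this

section Trigonometry

variable {N : ℕ} [NeZero N]

lemma zcos_sq_add_zsin_sq (z : ZMod N) : zcos z ^ 2 + zsin z ^ 2 = 1 := by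
  have h : ‖ZMod.stdAddChar z‖ = 1 := by
    rw [ZMod.stdAddChar_apply, Circle.norm_coe]
  have h2 := Complex.sq_norm (ZMod.stdAddChar z)
  rw [h, Complex.normSq_apply] at h2
  simp only [zcos, zsin]
  nlinarith

lemma zcos_add (x y : ZMod N) : zcos (x + y) = zcos x * zcos y - zsin x * zsin y := by
  simp [zcos, zsin, AddChar.map_add_eq_mul]

lemma zsin_add (x y : ZMod N) : zsin (x + y) = zsin x * zcos y + zcos x * zsin y := by
  simp [zcos, zsin, AddChar.map_add_eq_mul]
  ring

lemma zcos_neg (x : ZMod N) : zcos (-x) = zcos x := by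
  simp [zcos, AddChar.map_neg_eq_conj]

lemma zsin_neg (x : ZMod N) : zsin (-x) = -zsin x := by
  simp [zsin, AddChar.map_neg_eq_conj]

lemma abs_zcos_le_one (x : ZMod N) : |zcos x| ≤ 1 := by
  rw [abs_le_one_iff_mul_self_le_one]
  nlinarith [zcos_sq_add_zsin_sq x, sq_nonneg (zsin x)]

lemma zsin_sq_le_one (x : ZMod N) : zsin x ^ 2 ≤ 1 := by
  nlinarith [zcos_sq_add_zsin_sq x, sq_nonneg (zcos x)]

lemma abs_zsin_sub_le (x y : ZMod N) : |zsin (x - y)| ≤ |zsin x| + |zsin y| := by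
  rw [sub_eq_add_neg, zsin_add, zcos_neg, zsin_neg]
  calc |zsin x * zcos y + zcos x * -zsin y|
      ≤ |zsin x * zcos y| + |zcos x * -zsin y| := abs_add_le _ _
    _ = |zsin x| * |zcos y| + |zcos x| * |zsin y| := by rw [abs_mul, abs_mul, abs_neg]
    _ ≤ |zsin x| * 1 + 1 * |zsin y| := by
      gcongr <;> exact abs_zcos_le_one _
    _ = _ := by ring

lemma zcos_two_mul (x : ZMod N) : zcos (2 * x) = 1 - 2 * zsin x ^ 2 := by
  rw [two_mul, zcos_add]
  nlinarith [zcos_sq_add_zsin_sq x]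

lemma zsin_intCast (k : ℤ) : zsin (k : ZMod N) = Real.sin (2 * Real.pi * k / N) := by
  rw [zsin, ZMod.stdAddChar_coe]
  have : (2 * Real.pi * Complex.I * k / N : ℂ) = ((2 * Real.pi * k / N : ℝ) : ℂ) * Complex.I := by
    push_cast; ring
  rw [this, Complex.exp_ofReal_mul_I_im]

lemma eq_zero_of_zsin_eq_zero (hN : Odd N) {z : ZMod N} (hz : zsin z = 0) : z = 0 := by
  have h1 : ZMod.stdAddChar (2 * z) = ZMod.stdAddChar (0 : ZMod N) := by
    apply Complex.ext
    · have := zcos_two_mul z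
      rw [hz] at this
      simpa [zcos] using this
    · have := zsin_add z z
      rw [hz, ← two_mul] at this
      simpa [zsin] using this
  have h2 := ZMod.injective_stdAddChar h1
  exact (isUnit_two_of_odd hN).mul_right_eq_zero.1 h2

lemma sum_zcos (ζ : ZMod N) : ∑ x : ZMod N, zcos (x * ζ) = if ζ = 0 then (N : ℝ) else 0 := by
  have h := AddChar.sum_mulShift ζ (ZMod.isPrimitive_stdAddChar N)
  have h2 := congrArg Complex.re h
  rw [Complex.re_sum] at h2
  simp only [zcos]
  rw [h2]
  split_ifs <;> simp

lemma card_mul_zeroCount {n : ℕ} (v : Fin n → ZMod N) :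
    (N : ℝ) * zeroCount v = ∑ ξ : ZMod N, ∏ i, (2 * zcos (ξ * v i)) := by
  have key : ∀ ξ : ZMod N, ((∏ i, (2 * zcos (ξ * v i)) : ℝ) : ℂ) =
      ∑ x : Fin n → Bool, ZMod.stdAddChar (ξ * signedSum v x) := by
    intro ξ
    have h1 : ∀ i, ((2 * zcos (ξ * v i) : ℝ) : ℂ) =
        ∑ b : Bool, ZMod.stdAddChar (ξ * (if b then v i else -v i)) := by
      intro i
      simp only [Fintype.sum_bool, if_true, Bool.false_eq_true, if_false, mul_neg,
        AddChar.map_neg_eq_conj]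
      rw [Complex.add_conj, zcos]
    rw [Complex.ofReal_prod, Finset.prod_congr rfl fun i _ => h1 i, Finset.prod_univ_sum,
      Fintype.piFinset_univ]
    refine Finset.sum_congr rfl fun x _ => ?_
    rw [signedSum, Finset.mul_sum, addChar_map_sum]
  have : (((N : ℝ) * zeroCount v : ℝ) : ℂ) =
      ((∑ ξ : ZMod N, ∏ i, (2 * zcos (ξ * v i)) : ℝ) : ℂ) := by
    rw [Complex.ofReal_sum, Finset.sum_congr rfl fun ξ _ => key ξ, Finset.sum_comm]
    simp_rw [AddChar.sum_mulShift _ (ZMod.isPrimitive_stdAddChar N)]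
    simp [zeroCount, Finset.sum_ite, mul_comm]
  exact_mod_cast this

/-- Bessel's inequality for the cosine transform. -/
lemma sum_sq_cosTransform_le (g : ZMod N → ℝ) :
    ∑ x : ZMod N, (∑ ξ, g ξ * zcos (x * ξ)) ^ 2 ≤ N * ∑ ξ, g ξ ^ 2 := by
  have h1 : ∀ x : ZMod N, (∑ ξ, g ξ * zcos (x * ξ)) ^ 2 =
      ∑ ξ, ∑ η, g ξ * g η * ((zcos (x * (ξ - η)) + zcos (x * (ξ + η))) / 2) := by
    intro x
    rw [sq, Finset.sum_mul_sum]
    refine Finset.sum_congr rfl fun ξ _ => Finset.sum_congr rfl fun η _ => ?_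
    rw [mul_sub, mul_add, sub_eq_add_neg, zcos_add, zcos_add, zcos_neg, zsin_neg]
    ring
  have h2 : ∀ ξ η : ZMod N,
      ∑ x : ZMod N, g ξ * g η * ((zcos (x * (ξ - η)) + zcos (x * (ξ + η))) / 2) =
      g ξ * g η * (((if η = ξ then (N : ℝ) else 0) + (if η = -ξ then (N : ℝ) else 0)) / 2) := by
    intro ξ η
    rw [← Finset.mul_sum, ← Finset.sum_div, Finset.sum_add_distrib, sum_zcos, sum_zcos]
    have e1 : ξ - η = 0 ↔ η = ξ := by rw [sub_eq_zero, eq_comm]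
    have e2 : ξ + η = 0 ↔ η = -ξ := by rw [add_comm, add_eq_zero_iff_eq_neg]
    simp only [e1, e2]
  rw [Finset.sum_congr rfl fun x _ => h1 x, Finset.sum_comm]
  have h3 : ∀ ξ : ZMod N, ∑ x : ZMod N,
      ∑ η, g ξ * g η * ((zcos (x * (ξ - η)) + zcos (x * (ξ + η))) / 2) =
      N / 2 * (g ξ ^ 2 + g ξ * g (-ξ)) := by
    intro ξ
    rw [Finset.sum_comm, Finset.sum_congr rfl fun η _ => h2 ξ η]
    simp only [add_div, mul_add, Finset.sum_add_distrib, ite_div, zero_div, mul_ite, mul_zero,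
      Finset.sum_ite_eq', Finset.mem_univ, if_true]
    ring
  rw [Finset.sum_congr rfl fun x _ => h3 x, ← Finset.mul_sum, Finset.sum_add_distrib]
  have h4 : ∑ ξ : ZMod N, g ξ * g (-ξ) ≤ ∑ ξ, g ξ ^ 2 := by
    have h5 : ∑ ξ : ZMod N, g (-ξ) ^ 2 = ∑ ξ, g ξ ^ 2 :=
      Equiv.sum_comp (Equiv.neg (ZMod N)) fun ξ => g ξ ^ 2
    have h6 : ∑ ξ : ZMod N, g ξ * g (-ξ) ≤ ∑ ξ : ZMod N, (g ξ ^ 2 + g (-ξ) ^ 2) / 2 :=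
      Finset.sum_le_sum fun ξ _ => by nlinarith [sq_nonneg (g ξ - g (-ξ))]
    rw [← Finset.sum_div, Finset.sum_add_distrib, h5] at h6
    linarith
  have hN : (0 : ℝ) ≤ N := by positivity
  nlinarith

end Trigonometry

section Damping

variable {N : ℕ} [NeZero N]

/-- The characteristic function at `z` of a lazy sign, nonzero with probability `(1 - γ) / 4`
up to doubling the step. -/
noncomputable def lazyFactor (γ : ℝ) (z : ZMod N) : ℝ := 1 - (1 - γ) / 2 * zsin z ^ 2

lemma lazyFactor_eq (γ : ℝ) (z : ZMod N) :
    lazyFactor γ z = (3 + γ) / 4 + (1 - γ) / 4 * zcos (2 * z) := by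
  rw [lazyFactor, zcos_two_mul]; ring

lemma lazyFactor_nonneg {γ : ℝ} (h0 : 0 ≤ γ) (z : ZMod N) : 0 ≤ lazyFactor γ z := by
  rw [lazyFactor]
  nlinarith [zsin_sq_le_one z, sq_nonneg (zsin z)]

lemma lazyFactor_le_one {γ : ℝ} (h1 : γ ≤ 1) (z : ZMod N) : lazyFactor γ z ≤ 1 := by
  rw [lazyFactor]
  nlinarith [sq_nonneg (zsin z)]

/-- `|cos|` is dominated by the lazy factor with an exponential gain. -/
lemma abs_zcos_le_lazyFactor_mul_exp {γ : ℝ} (h0 : 0 ≤ γ) (h1 : γ ≤ 1) (z : ZMod N) :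
    |zcos z| ≤ lazyFactor γ z * Real.exp (-(γ / 2 * zsin z ^ 2)) := by
  have hs := zsin_sq_le_one z
  have hs0 := sq_nonneg (zsin z)
  have hc := zcos_sq_add_zsin_sq z
  have e := Real.add_one_le_exp (-(γ / 2 * zsin z ^ 2))
  have h2 : |zcos z| ≤ 1 - zsin z ^ 2 / 2 := by
    refine abs_le_of_sq_le_sq ?_ (by linarith)
    nlinarith [sq_nonneg (zsin z ^ 2)]
  calc |zcos z| ≤ 1 - zsin z ^ 2 / 2 := h2
    _ ≤ lazyFactor γ z * (-(γ / 2 * zsin z ^ 2) + 1) := by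
      rw [lazyFactor]
      nlinarith [mul_nonneg (mul_nonneg h0 (sub_nonneg.2 h1)) (mul_nonneg hs0 hs0)]
    _ ≤ _ := mul_le_mul_of_nonneg_left e (lazyFactor_nonneg h0 z)

open Classical in
/-- Few frequencies correlate with a bounded weight of large mass. -/
lemma card_large_cosTransform_mul_le (hN : Odd N) {γ : ℝ} (h0 : 0 < γ) {g : ZMod N → ℝ}
    (hg0 : ∀ ξ, 0 ≤ g ξ) (hg1 : ∀ ξ, g ξ ≤ 1) (hG : 0 < ∑ ξ, g ξ) :
    (#{x : ZMod N | γ * ∑ ξ, g ξ ≤ ∑ ξ, g ξ * zcos (2 * (ξ * x))} : ℝ) * (γ ^ 2 * ∑ ξ, g ξ)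
      ≤ N := by
  set G := ∑ ξ, g ξ with hGdef
  set S : Finset (ZMod N) := {x : ZMod N | γ * G ≤ ∑ ξ, g ξ * zcos (2 * (ξ * x))}
  have h1 : (#S : ℝ) * (γ * G) ^ 2 ≤ ∑ x : ZMod N, (∑ ξ, g ξ * zcos (2 * (ξ * x))) ^ 2 := by
    calc (#S : ℝ) * (γ * G) ^ 2 = ∑ x ∈ S, (γ * G) ^ 2 := by simp
      _ ≤ ∑ x ∈ S, (∑ ξ, g ξ * zcos (2 * (ξ * x))) ^ 2 := by
        refine Finset.sum_le_sum fun x hx => ?_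
        have hx' : γ * G ≤ ∑ ξ, g ξ * zcos (2 * (ξ * x)) := (Finset.mem_filter.1 hx).2
        gcongr
      _ ≤ _ := Finset.sum_le_sum_of_subset_of_nonneg (Finset.subset_univ _)
        fun _ _ _ => sq_nonneg _
  have h2 : ∑ x : ZMod N, (∑ ξ, g ξ * zcos (2 * (ξ * x))) ^ 2 =
      ∑ x : ZMod N, (∑ ξ, g ξ * zcos (x * ξ)) ^ 2 := by
    refine Fintype.sum_equiv (isUnit_two_of_odd hN).unit.mulLeft _ _ fun x => ?_
    simp only [Units.mulLeft_apply, IsUnit.unit_spec]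
    congr 1
    refine Finset.sum_congr rfl fun ξ _ => ?_
    rw [mul_assoc, mul_comm ξ x]
  have h3 : ∑ ξ, g ξ ^ 2 ≤ G :=
    Finset.sum_le_sum fun ξ _ => by nlinarith [hg0 ξ, hg1 ξ]
  have h4 := sum_sq_cosTransform_le g
  have h5 : (N : ℝ) * ∑ ξ, g ξ ^ 2 ≤ N * G := by gcongr
  have h6 : (#S : ℝ) * (γ ^ 2 * G) * G ≤ N * G := by
    calc (#S : ℝ) * (γ ^ 2 * G) * G = (#S : ℝ) * (γ * G) ^ 2 := by ring
      _ ≤ N * G := by linarith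
  exact le_of_mul_le_mul_right h6 hG

open Classical in
/-- Exposing coordinates one at a time: few vectors keep the lazy product large. -/
lemma card_large_lazyProduct_le (hN : Odd N) {γ L : ℝ} (h0 : 0 < γ) (h1 : γ < 1) (hL : 0 < L)
    {s : ℕ} (hs : 1 ≤ γ ^ 2 * L * (3 / 4 + γ / 2) ^ s) (m : ℕ) :
    ∀ g : ZMod N → ℝ, (∀ ξ, 0 ≤ g ξ) → (∀ ξ, g ξ ≤ 1) →
    (#{v : Fin m → ZMod N | L ≤ ∑ ξ, g ξ * ∏ i, lazyFactor γ (ξ * v i)} : ℝ) ≤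
      (2 * N * (3 / 4 + γ / 2) ^ s) ^ m * ((∑ ξ, g ξ) / L) ^ s := by
  set a : ℝ := 3 / 4 + γ / 2 with ha
  have ha0 : 0 < a := by positivity
  induction m with
  | zero =>
    intro g hg0 hg1
    by_cases h : L ≤ ∑ ξ, g ξ
    · have : (1 : ℝ) ≤ ((∑ ξ, g ξ) / L) ^ s := one_le_pow₀ ((one_le_div hL).2 h)
      simpa [h] using this
    · have : 0 ≤ ((∑ ξ, g ξ) / L) ^ s :=
        pow_nonneg (div_nonneg (Finset.sum_nonneg fun ξ _ => hg0 ξ) hL.le) _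
      simpa [h] using this
  | succ m ih =>
    intro g hg0 hg1
    set G := ∑ ξ, g ξ with hG
    have hG0 : 0 ≤ G := Finset.sum_nonneg fun ξ _ => hg0 ξ
    set g' : ZMod N → ZMod N → ℝ := fun x ξ => g ξ * lazyFactor γ (ξ * x)
    have hg'0 : ∀ x ξ, 0 ≤ g' x ξ := fun x ξ =>
      mul_nonneg (hg0 ξ) (lazyFactor_nonneg h0.le _)
    have hg'g : ∀ x ξ, g' x ξ ≤ g ξ := fun x ξ =>
      mul_le_of_le_one_right (hg0 ξ) (lazyFactor_le_one h1.le _)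
    have hsplit : (#{v : Fin (m + 1) → ZMod N |
        L ≤ ∑ ξ, g ξ * ∏ i, lazyFactor γ (ξ * v i)} : ℝ) =
        ∑ x : ZMod N, (#{v : Fin m → ZMod N |
          L ≤ ∑ ξ, g' x ξ * ∏ i, lazyFactor γ (ξ * v i)} : ℝ) := by
      simp only [Finset.natCast_card_filter]
      rw [← Fintype.sum_prod_type']
      symm
      refine Fintype.sum_equiv (Fin.consEquiv fun _ => ZMod N) _ _ fun p => ?_
      simp [Fin.consEquiv, Fin.prod_univ_succ, g', mul_assoc]
    rw [hsplit]
    by_cases hLG : L ≤ G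
    · set S : Finset (ZMod N) := {x : ZMod N | γ * G ≤ ∑ ξ, g ξ * zcos (2 * (ξ * x))}
      have hbad : (#S : ℝ) ≤ N * a ^ s := by
        have hb := card_large_cosTransform_mul_le hN h0 hg0 hg1 (lt_of_lt_of_le hL hLG)
        have hb2 : (#S : ℝ) * (γ ^ 2 * L) ≤ N :=
          le_trans (by gcongr) hb
        calc (#S : ℝ) ≤ #S * (γ ^ 2 * L * a ^ s) := le_mul_of_one_le_right (by positivity) hs
          _ = (#S * (γ ^ 2 * L)) * a ^ s := by ring
          _ ≤ N * a ^ s := by gcongr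
      set C : ℝ := (2 * N * a ^ s) ^ m * (G / L) ^ s
      have hC0 : 0 ≤ C := by positivity
      have hpt : ∀ x : ZMod N, (#{v : Fin m → ZMod N |
          L ≤ ∑ ξ, g' x ξ * ∏ i, lazyFactor γ (ξ * v i)} : ℝ) ≤
          (if x ∈ S then C else 0) + a ^ s * C := by
        intro x
        have hx := ih (g' x) (hg'0 x) fun ξ => (hg'g x ξ).trans (hg1 ξ)
        have hx0 : 0 ≤ ∑ ξ, g' x ξ := Finset.sum_nonneg fun ξ _ => hg'0 x ξ
        by_cases hxS : x ∈ S
        · rw [if_pos hxS]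
          have : ∑ ξ, g' x ξ ≤ G := Finset.sum_le_sum fun ξ _ => hg'g x ξ
          have h3 : (2 * N * a ^ s) ^ m * ((∑ ξ, g' x ξ) / L) ^ s ≤ C := by
            simp only [C]
            gcongr
          have : 0 ≤ a ^ s * C := by positivity
          linarith
        · rw [if_neg hxS, zero_add]
          have hlt : ∑ ξ, g ξ * zcos (2 * (ξ * x)) < γ * G := by
            simpa [S] using hxS
          have h3 : ∑ ξ, g' x ξ ≤ a * G := by
            have : ∑ ξ, g' x ξ =
                (3 + γ) / 4 * G + (1 - γ) / 4 * ∑ ξ, g ξ * zcos (2 * (ξ * x)) := by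
              simp only [g', lazyFactor_eq, hG]
              rw [Finset.mul_sum, Finset.mul_sum, ← Finset.sum_add_distrib]
              exact Finset.sum_congr rfl fun ξ _ => by ring
            rw [this, ha]
            nlinarith [mul_nonneg (mul_nonneg h0.le h0.le) hG0]
          calc _ ≤ _ := hx
            _ ≤ (2 * N * a ^ s) ^ m * (a * G / L) ^ s := by gcongr
            _ = a ^ s * C := by
              simp only [C]
              rw [mul_div_assoc, mul_pow a]; ring
      calc _ ≤ ∑ x : ZMod N, ((if x ∈ S then C else 0) + a ^ s * C) :=
            Finset.sum_le_sum fun x _ => hpt x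
        _ = #S * C + N * (a ^ s * C) := by
          rw [Finset.sum_add_distrib]
          simp [ZMod.card]
        _ ≤ N * a ^ s * C + N * (a ^ s * C) := by gcongr
        _ = _ := by simp only [C]; rw [pow_succ (2 * (N : ℝ) * a ^ s)]; ring
    · have hz : ∀ x : ZMod N, (#{v : Fin m → ZMod N |
          L ≤ ∑ ξ, g' x ξ * ∏ i, lazyFactor γ (ξ * v i)} : ℝ) = 0 := by
        intro x
        rw [Nat.cast_eq_zero, Finset.card_eq_zero, Finset.filter_eq_empty_iff]
        intro v _ hv
        refine hLG (hv.trans (Finset.sum_le_sum fun ξ _ => ?_))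
        refine (mul_le_of_le_one_right (hg'0 x ξ) ?_).trans (hg'g x ξ)
        exact Finset.prod_le_one (fun i _ => lazyFactor_nonneg h0.le _)
          fun i _ => lazyFactor_le_one h1.le _
      rw [Finset.sum_congr rfl fun x _ => hz x, Finset.sum_const_zero]
      positivity

end Damping

section Structured

variable {N : ℕ} [NeZero N]

/-- A small nonzero angle has well separated multiples. -/
lemma exists_separated_multiples {α : ℝ} {T : ℕ} (hT : 0 < T) (hα0 : α ≠ 0)
    (hα : |α| ≤ Real.pi / (2 * T)) :
    ∃ K : ℕ, ∀ d : ℕ, 0 < d → d < T → 1 / (2 * (T : ℝ)) ≤ |Real.sin (d * K * α)| := by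
  have hT' : (0 : ℝ) < T := by exact_mod_cast hT
  have hpi := Real.pi_pos
  have hα' : 0 < |α| := abs_pos.2 hα0
  set y : ℝ := Real.pi / (2 * T) / |α| with hy
  have hy1 : 1 ≤ y := (one_le_div hα').2 hα
  have hyα : y * |α| = Real.pi / (2 * T) := div_mul_cancel₀ _ hα'.ne'
  have hKy : (⌊y⌋₊ : ℝ) ≤ y := Nat.floor_le (by linarith)
  have hyK : y / 2 ≤ (⌊y⌋₊ : ℝ) := by
    have h1 : (1 : ℝ) ≤ (⌊y⌋₊ : ℝ) := by exact_mod_cast Nat.one_le_floor_iff y |>.2 hy1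
    have h2 := Nat.lt_floor_add_one y
    linarith
  refine ⟨⌊y⌋₊, fun d hd0 hdT => ?_⟩
  have hd0' : (1 : ℝ) ≤ d := by exact_mod_cast hd0
  have hdT' : (d : ℝ) ≤ T := by exact_mod_cast hdT.le
  have habs : |(d : ℝ) * ⌊y⌋₊ * α| = d * (⌊y⌋₊ * |α|) := by
    rw [abs_mul, abs_mul, Nat.abs_cast, Nat.abs_cast, mul_assoc]
  have hup : |(d : ℝ) * ⌊y⌋₊ * α| ≤ Real.pi / 2 := by
    rw [habs]
    calc (d : ℝ) * (⌊y⌋₊ * |α|) ≤ T * (y * |α|) := by gcongr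
      _ = Real.pi / 2 := by rw [hyα]; field_simp
  have hlow : Real.pi / (4 * T) ≤ |(d : ℝ) * ⌊y⌋₊ * α| := by
    rw [habs]
    calc Real.pi / (4 * T) = 1 * (y / 2 * |α|) := by
          rw [one_mul, div_mul_eq_mul_div, hyα]; field_simp; norm_num
      _ ≤ d * (⌊y⌋₊ * |α|) := by gcongr
  refine le_trans ?_ (Real.mul_abs_le_abs_sin hup)
  calc 1 / (2 * (T : ℝ)) = 2 / Real.pi * (Real.pi / (4 * T)) := by field_simp; norm_num
    _ ≤ _ := by gcongr

/-- An angle class with small nonzero sine has well separated multiples. -/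
lemma exists_separated_zsin {z : ZMod N} {T : ℕ} (hT : 0 < T) (hz0 : zsin z ≠ 0)
    (hz : |zsin z| ≤ 1 / T) :
    ∃ K : ℕ, ∀ d : ℕ, 0 < d → d < T →
      1 / (2 * (T : ℝ)) ≤ |zsin (((d * K : ℕ) : ZMod N) * z)| := by
  have hpi := Real.pi_pos
  have hT' : (0 : ℝ) < T := by exact_mod_cast hT
  set t : ℤ := (z.val : ℤ)
  have hzt : z = (t : ZMod N) := by simp [t]
  set β : ℝ := 2 * Real.pi * t / N
  set α : ℝ := β - round (β / Real.pi) * Real.pi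
  have hsin : ∀ k : ℕ, |zsin ((k : ZMod N) * z)| = |Real.sin (k * α)| := by
    intro k
    have h1 : (k : ZMod N) * z = (((k : ℤ) * t : ℤ) : ZMod N) := by rw [hzt]; push_cast; rfl
    have h2 : 2 * Real.pi * (((k : ℤ) * t : ℤ) : ℝ) / N =
        k * α + ((k * round (β / Real.pi) : ℤ) : ℝ) * Real.pi := by
      simp only [α, β]; push_cast; ring
    rw [h1, zsin_intCast, h2, Real.sin_add_int_mul_pi, abs_mul, abs_neg_one_zpow, one_mul]
  have hz1 : |zsin z| = |Real.sin α| := by simpa using hsin 1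
  have hαpi : |α| ≤ Real.pi / 2 := by
    have h := abs_sub_round (β / Real.pi)
    have h2 : α = (β / Real.pi - round (β / Real.pi)) * Real.pi := by
      simp only [α]; field_simp
    rw [h2, abs_mul, abs_of_pos hpi]
    nlinarith
  have hα0 : α ≠ 0 := by
    intro h
    rw [h, Real.sin_zero, abs_zero, abs_eq_zero] at hz1
    exact hz0 hz1
  have hα : |α| ≤ Real.pi / (2 * T) := by
    have h := Real.mul_abs_le_abs_sin hαpi
    rw [← hz1] at h
    have h2 : 2 / Real.pi * |α| ≤ 1 / T := h.trans hz
    calc |α| = Real.pi / 2 * (2 / Real.pi * |α|) := by field_simp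
      _ ≤ Real.pi / 2 * (1 / T) := by gcongr
      _ = _ := by field_simp
  obtain ⟨K, hK⟩ := exists_separated_multiples hT hα0 hα
  refine ⟨K, fun d hd0 hdT => ?_⟩
  rw [hsin]
  simpa using hK d hd0 hdT

open Classical in
/-- If some multiple of `ξ` has small nonzero sine, then only a small proportion do. -/
lemma card_small_zsin_mul_le {ξ u : ZMod N} {T : ℕ} (hT : 0 < T) (hz0 : zsin (ξ * u) ≠ 0)
    (hz : |zsin (ξ * u)| ≤ 1 / T) :
    #{x : ZMod N | |zsin (ξ * x)| < 1 / (4 * (T : ℝ))} * T ≤ N := by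
  obtain ⟨K, hK⟩ := exists_separated_zsin hT hz0 hz
  set B : Finset (ZMod N) := {x : ZMod N | |zsin (ξ * x)| < 1 / (4 * (T : ℝ))}
  have hinj : Set.InjOn (fun p : ZMod N × ℕ => p.1 + ((p.2 * K : ℕ) : ZMod N) * u)
      (B ×ˢ Finset.range T : Finset (ZMod N × ℕ)) := by
    have key : ∀ x ∈ B, ∀ x' ∈ B, ∀ i j : ℕ, i < j → j < T →
        x + ((i * K : ℕ) : ZMod N) * u ≠ x' + ((j * K : ℕ) : ZMod N) * u := by
      intro x hx x' hx' i j hij hj heq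
      have h1 := hK (j - i) (by omega) (by omega)
      have h2 : (((j - i) * K : ℕ) : ZMod N) * (ξ * u) = ξ * x - ξ * x' := by
        have : ((j : ℕ) : ZMod N) = ((j - i : ℕ) : ZMod N) + (i : ZMod N) := by
          rw [← Nat.cast_add, Nat.sub_add_cancel hij.le]
        push_cast at heq ⊢
        rw [this] at heq
        linear_combination -ξ * heq
      rw [h2] at h1
      have h3 := abs_zsin_sub_le (ξ * x) (ξ * x')
      have h4 : |zsin (ξ * x)| < 1 / (4 * (T : ℝ)) := (Finset.mem_filter.1 hx).2
      have h5 : |zsin (ξ * x')| < 1 / (4 * (T : ℝ)) := (Finset.mem_filter.1 hx').2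
      have h6 : 1 / (2 * (T : ℝ)) = 1 / (4 * (T : ℝ)) + 1 / (4 * (T : ℝ)) := by
        field_simp; norm_num
      linarith
    rintro ⟨x, i⟩ hp ⟨x', j⟩ hq heq
    simp only [Finset.coe_product, Set.mem_prod, Finset.mem_coe, Finset.mem_range] at hp hq
    rcases lt_trichotomy i j with h | h | h
    · exact absurd heq (key x hp.1 x' hq.1 i j h hq.2)
    · subst h
      simpa using heq
    · exact absurd heq.symm (key x' hq.1 x hp.1 j i h hp.2)
  have := Finset.card_le_card_of_injOn _ (fun p _ => Finset.mem_univ _) hinj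
  simpa [ZMod.card] using this

/-- Exponential Markov inequality for a sum over the coordinates of a uniform vector. -/
lemma card_sum_le_le_exp_mul_pow {β : Type*} [Fintype β] (n : ℕ) (q : β → ℝ) (R t : ℝ)
    (ht : 0 ≤ t) [DecidablePred fun v : Fin n → β => ∑ i, q (v i) ≤ R] :
    (#{v : Fin n → β | ∑ i, q (v i) ≤ R} : ℝ) ≤
      Real.exp (t * R) * (∑ x, Real.exp (-(t * q x))) ^ n := by
  have h1 : (∑ x, Real.exp (-(t * q x))) ^ n =
      ∑ v : Fin n → β, Real.exp (-(t * ∑ i, q (v i))) := by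
    have := Finset.prod_univ_sum (fun _ : Fin n => (Finset.univ : Finset β))
      (fun _ x => Real.exp (-(t * q x)))
    rw [Fintype.piFinset_univ, Finset.prod_const, Finset.card_univ, Fintype.card_fin] at this
    rw [this]
    refine Finset.sum_congr rfl fun v _ => ?_
    rw [← Real.exp_sum, Finset.mul_sum, Finset.sum_neg_distrib]
  rw [h1, Finset.mul_sum, Finset.natCast_card_filter]
  refine Finset.sum_le_sum fun v _ => ?_
  rw [← Real.exp_add]
  split_ifs with h
  · rw [← Real.exp_zero]
    apply Real.exp_le_exp.2
    nlinarith
  · exact (Real.exp_pos _).le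

open Classical in
/-- Few vectors with many unit coordinates have a nonzero frequency at which all but a bounded
amount of the coordinates resonate. -/
lemma card_resonant_le (hN : Odd N) (n : ℕ) {R : ℝ} {b T : ℕ} (hT : 0 < T)
    (hb : R * T ^ 2 ≤ b) :
    (#{v : Fin n → ZMod N | b < #{i | IsUnit (v i)} ∧
      ∃ ξ : ZMod N, ξ ≠ 0 ∧ ∑ i, zsin (ξ * v i) ^ 2 ≤ R} : ℝ) ≤
      N * (Real.exp (16 * T ^ 3 * R) * (2 * N / T) ^ n) := by
  have hT' : (0 : ℝ) < T := by exact_mod_cast hT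
  set V : ZMod N → Finset (Fin n → ZMod N) := fun ξ =>
    {v : Fin n → ZMod N | ξ ≠ 0 ∧ b < #{i | IsUnit (v i)} ∧ ∑ i, zsin (ξ * v i) ^ 2 ≤ R}
  have hsub : ({v : Fin n → ZMod N | b < #{i | IsUnit (v i)} ∧
      ∃ ξ : ZMod N, ξ ≠ 0 ∧ ∑ i, zsin (ξ * v i) ^ 2 ≤ R} : Finset _) ⊆
      Finset.univ.biUnion V := by
    intro v hv
    obtain ⟨-, h1, ξ, h2, h3⟩ := Finset.mem_filter.1 hv
    exact Finset.mem_biUnion.2 ⟨ξ, Finset.mem_univ _,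
      Finset.mem_filter.2 ⟨Finset.mem_univ _, h2, h1, h3⟩⟩
  have hV : ∀ ξ, (#(V ξ) : ℝ) ≤ Real.exp (16 * T ^ 3 * R) * (2 * N / T) ^ n := by
    intro ξ
    rcases (V ξ).eq_empty_or_nonempty with hemp | ⟨v, hv⟩
    · rw [hemp]; simp only [Finset.card_empty, Nat.cast_zero]; positivity
    obtain ⟨-, hξ, hunit, hsum⟩ := Finset.mem_filter.1 hv
    obtain ⟨i, hi, hsm⟩ : ∃ i, IsUnit (v i) ∧ zsin (ξ * v i) ^ 2 ≤ (1 / T) ^ 2 := by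
      by_contra! hcon
      have h1 : (#{i | IsUnit (v i)} : ℝ) * (1 / T) ^ 2 ≤ R := by
        calc (#{i | IsUnit (v i)} : ℝ) * (1 / T) ^ 2
            = ∑ i with IsUnit (v i), (1 / (T : ℝ)) ^ 2 := by simp
          _ ≤ ∑ i with IsUnit (v i), zsin (ξ * v i) ^ 2 :=
            Finset.sum_le_sum fun i hi => (hcon i (Finset.mem_filter.1 hi).2).le
          _ ≤ ∑ i, zsin (ξ * v i) ^ 2 :=
            Finset.sum_le_sum_of_subset_of_nonneg (Finset.subset_univ _)
              fun _ _ _ => sq_nonneg _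
          _ ≤ R := hsum
      have h2 : (b : ℝ) < #{i | IsUnit (v i)} := by exact_mod_cast hunit
      have h3 : (#{i | IsUnit (v i)} : ℝ) ≤ R * T ^ 2 := by
        calc (#{i | IsUnit (v i)} : ℝ) = #{i | IsUnit (v i)} * (1 / T) ^ 2 * T ^ 2 := by
              field_simp
          _ ≤ R * T ^ 2 := by gcongr
      linarith
    have hne : zsin (ξ * v i) ≠ 0 := by
      intro h
      exact hξ (hi.mul_left_eq_zero.1 (eq_zero_of_zsin_eq_zero hN h))
    have hcard := card_small_zsin_mul_le hT hne (abs_le_of_sq_le_sq hsm (by positivity))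
    set B : Finset (ZMod N) := {x : ZMod N | |zsin (ξ * x)| < 1 / (4 * (T : ℝ))}
    have hB : (#B : ℝ) ≤ N / T := by
      rw [le_div_iff₀ hT']
      exact_mod_cast hcard
    have hsumexp : ∑ x : ZMod N, Real.exp (-(16 * T ^ 3 * zsin (ξ * x) ^ 2)) ≤ 2 * N / T := by
      have hpt : ∀ x : ZMod N, Real.exp (-(16 * T ^ 3 * zsin (ξ * x) ^ 2)) ≤
          (if x ∈ B then 1 else 0) + 1 / T := by
        intro x
        by_cases hx : x ∈ B
        · rw [if_pos hx]
          have : Real.exp (-(16 * T ^ 3 * zsin (ξ * x) ^ 2)) ≤ 1 := by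
            rw [Real.exp_le_one_iff]
            have : 0 ≤ 16 * (T : ℝ) ^ 3 * zsin (ξ * x) ^ 2 := by positivity
            linarith
          have : 0 ≤ 1 / (T : ℝ) := by positivity
          linarith
        · rw [if_neg hx, zero_add]
          have h1 : 1 / (4 * (T : ℝ)) ≤ |zsin (ξ * x)| := by simpa [B] using hx
          have h2 : (1 / (4 * (T : ℝ))) ^ 2 ≤ zsin (ξ * x) ^ 2 := by
            rw [← sq_abs (zsin (ξ * x))]; gcongr
          have h3 : (T : ℝ) ≤ 16 * T ^ 3 * zsin (ξ * x) ^ 2 := by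
            calc (T : ℝ) = 16 * T ^ 3 * (1 / (4 * (T : ℝ))) ^ 2 := by field_simp; norm_num
              _ ≤ _ := by gcongr
          rw [Real.exp_neg, one_div]
          apply inv_anti₀ hT'
          linarith [Real.add_one_le_exp (16 * (T : ℝ) ^ 3 * zsin (ξ * x) ^ 2)]
      calc _ ≤ ∑ x : ZMod N, ((if x ∈ B then (1 : ℝ) else 0) + 1 / T) :=
            Finset.sum_le_sum fun x _ => hpt x
        _ = #B + N / T := by
          rw [Finset.sum_add_distrib]
          simp [ZMod.card, div_eq_mul_inv]
        _ ≤ N / T + N / T := by gcongr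
        _ = _ := by ring
    calc (#(V ξ) : ℝ) ≤ #{v : Fin n → ZMod N | ∑ i, zsin (ξ * v i) ^ 2 ≤ R} := by
          exact_mod_cast Finset.card_le_card fun v hv => by
            have := Finset.mem_filter.1 hv
            exact Finset.mem_filter.2 ⟨Finset.mem_univ _, this.2.2.2⟩
      _ ≤ Real.exp (16 * T ^ 3 * R) *
          (∑ x : ZMod N, Real.exp (-(16 * T ^ 3 * zsin (ξ * x) ^ 2))) ^ n :=
        card_sum_le_le_exp_mul_pow n (fun x : ZMod N => zsin (ξ * x) ^ 2) R _ (by positivity)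
      _ ≤ _ := by gcongr
  calc _ ≤ (#(Finset.univ.biUnion V) : ℝ) := by exact_mod_cast Finset.card_le_card hsub
    _ ≤ ∑ ξ, (#(V ξ) : ℝ) := by exact_mod_cast Finset.card_biUnion_le
    _ ≤ ∑ ξ : ZMod N, Real.exp (16 * T ^ 3 * R) * (2 * N / T) ^ n :=
      Finset.sum_le_sum fun ξ _ => hV ξ
    _ = _ := by simp [ZMod.card]

end Structured

section Counting

variable {N : ℕ} [NeZero N]

/-- A vector with many vanishing signed sums is resonant or has a large lazy product. -/
lemma resonant_or_large_lazyProduct {n : ℕ} {v : Fin n → ZMod N} {γ R : ℝ} (h0 : 0 ≤ γ)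
    (h1 : γ ≤ 1) (hv : (2 : ℝ) * 2 ^ n ≤ N * zeroCount v) :
    (∃ ξ : ZMod N, ξ ≠ 0 ∧ ∑ i, zsin (ξ * v i) ^ 2 ≤ R) ∨
      Real.exp (γ / 2 * R) ≤ ∑ ξ : ZMod N, ∏ i, lazyFactor γ (ξ * v i) := by
  by_contra! hcon
  obtain ⟨hR, hlazy⟩ := hcon
  rw [card_mul_zeroCount] at hv
  have h2 : (2 : ℝ) ≤ ∑ ξ : ZMod N, ∏ i, |zcos (ξ * v i)| := by
    have h3 : ∑ ξ : ZMod N, ∏ i, (2 * zcos (ξ * v i)) ≤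
        2 ^ n * ∑ ξ : ZMod N, ∏ i, |zcos (ξ * v i)| := by
      rw [Finset.mul_sum]
      refine Finset.sum_le_sum fun ξ _ => ?_
      rw [Finset.prod_mul_distrib, Finset.prod_const, Finset.card_univ, Fintype.card_fin,
        ← Finset.abs_prod]
      exact mul_le_mul_of_nonneg_left (le_abs_self _) (by positivity)
    have h4 : (0 : ℝ) < 2 ^ n := by positivity
    nlinarith
  have hprod0 : ∀ ξ : ZMod N, 0 ≤ ∏ i, lazyFactor γ (ξ * v i) := fun ξ =>
    Finset.prod_nonneg fun i _ => lazyFactor_nonneg h0 _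
  have hpt : ∀ ξ : ZMod N, ∏ i, |zcos (ξ * v i)| ≤
      (if ξ = 0 then 1 else 0) + (∏ i, lazyFactor γ (ξ * v i)) * Real.exp (-(γ / 2 * R)) := by
    intro ξ
    by_cases hξ : ξ = 0
    · have : 0 ≤ (∏ i, lazyFactor γ (ξ * v i)) * Real.exp (-(γ / 2 * R)) :=
        mul_nonneg (hprod0 ξ) (Real.exp_pos _).le
      have : ∏ i, |zcos (ξ * v i)| ≤ 1 :=
        Finset.prod_le_one (fun _ _ => abs_nonneg _) fun _ _ => abs_zcos_le_one _
      rw [if_pos hξ]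
      linarith
    · rw [if_neg hξ, zero_add]
      calc ∏ i, |zcos (ξ * v i)|
          ≤ ∏ i, (lazyFactor γ (ξ * v i) * Real.exp (-(γ / 2 * zsin (ξ * v i) ^ 2))) :=
            Finset.prod_le_prod (fun _ _ => abs_nonneg _)
              fun i _ => abs_zcos_le_lazyFactor_mul_exp h0 h1 _
        _ = (∏ i, lazyFactor γ (ξ * v i)) * Real.exp (-(γ / 2 * ∑ i, zsin (ξ * v i) ^ 2)) := by
          rw [Finset.prod_mul_distrib, ← Real.exp_sum, Finset.mul_sum, Finset.sum_neg_distrib]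
        _ ≤ _ := by
          refine mul_le_mul_of_nonneg_left (Real.exp_le_exp.2 ?_) (hprod0 ξ)
          have := (hR ξ hξ).le
          gcongr
  have h5 : ∑ ξ : ZMod N, ∏ i, |zcos (ξ * v i)| ≤
      1 + (∑ ξ : ZMod N, ∏ i, lazyFactor γ (ξ * v i)) * Real.exp (-(γ / 2 * R)) := by
    refine (Finset.sum_le_sum fun ξ _ => hpt ξ).trans (le_of_eq ?_)
    rw [Finset.sum_add_distrib, Finset.sum_mul]
    simp
  have h6 : (∑ ξ : ZMod N, ∏ i, lazyFactor γ (ξ * v i)) * Real.exp (-(γ / 2 * R)) < 1 := by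
    calc _ < Real.exp (γ / 2 * R) * Real.exp (-(γ / 2 * R)) :=
          mul_lt_mul_of_pos_right hlazy (Real.exp_pos _)
      _ = 1 := by rw [← Real.exp_add, add_neg_cancel, Real.exp_zero]
  linarith

open Classical in
/-- Few vectors with many unit coordinates have many vanishing signed sums. -/
lemma card_large_zeroCount_le (hN : Odd N) (n : ℕ) {γ R : ℝ} (h0 : 0 < γ) (h1 : γ < 1)
    (hR : 0 ≤ R) {b s T : ℕ} (hT : 0 < T) (hb : R * T ^ 2 ≤ b)
    (hs : 1 ≤ γ ^ 2 * Real.exp (γ / 2 * R) * (3 / 4 + γ / 2) ^ s) :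
    (#{v : Fin n → ZMod N | b < #{i | IsUnit (v i)} ∧ (2 : ℝ) * 2 ^ n ≤ N * zeroCount v} : ℝ) ≤
      (2 * N * (3 / 4 + γ / 2) ^ s) ^ n * (N : ℝ) ^ s +
        N * (Real.exp (16 * T ^ 3 * R) * (2 * N / T) ^ n) := by
  have hA := card_large_lazyProduct_le hN h0 h1 (Real.exp_pos (γ / 2 * R)) hs n
    (fun _ => 1) (fun _ => zero_le_one) fun _ => le_rfl
  have hB := card_resonant_le hN n hT hb
  simp only [one_mul, Finset.sum_const, Finset.card_univ, ZMod.card, nsmul_eq_mul, mul_one] at hA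
  have hA2 : (2 * N * (3 / 4 + γ / 2) ^ s) ^ n * ((N : ℝ) / Real.exp (γ / 2 * R)) ^ s ≤
      (2 * N * (3 / 4 + γ / 2) ^ s) ^ n * (N : ℝ) ^ s := by
    gcongr
    exact div_le_self (by positivity) (Real.one_le_exp (by positivity))
  refine le_trans ?_ (add_le_add (hA.trans hA2) hB)
  rw [← Nat.cast_add]
  refine Nat.cast_le.2 (le_trans (Finset.card_le_card ?_) (Finset.card_union_le _ _))
  intro v hv
  obtain ⟨-, hu, hz⟩ := Finset.mem_filter.1 hv
  rcases resonant_or_large_lazyProduct (R := R) h0.le h1.le hz with h | h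
  · exact Finset.mem_union_right _ (Finset.mem_filter.2 ⟨Finset.mem_univ _, hu, h⟩)
  · exact Finset.mem_union_left _ (Finset.mem_filter.2 ⟨Finset.mem_univ _, h⟩)

end Counting

/-- The counting bound beats the number of vectors in a union bound. -/
lemma count_mul_pow_le {N θ a E : ℝ} {n s : ℕ} (hn : 0 < n) (hN : 1 ≤ N) (ha : 0 ≤ a)
    (hE : 0 ≤ E) (hθ : 3 / 4 ≤ θ) (hθs : 12 / θ * (a / θ) ^ s ≤ 1 / 2) (hNθ : N ≤ 6 / θ ^ n) :
    ((2 * N * a ^ s) ^ n * N ^ s + N * (E * (2 * N / 64) ^ n)) * (6 / N) ^ (n - 1) ≤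
      (6 ^ s + 6 * E) * (1 / 2) ^ n := by
  obtain ⟨m, rfl⟩ : ∃ m, n = m + 1 := ⟨n - 1, by omega⟩
  have hN0 : 0 < N := by linarith
  have hθ0 : 0 < θ := by linarith
  rw [Nat.add_sub_cancel]
  have e1 : (6 / N) ^ m = 6 ^ (m + 1) * N / (6 * N ^ (m + 1)) := by
    rw [div_pow, pow_succ, pow_succ]; field_simp
  have hA : (2 * N * a ^ s) ^ (m + 1) * N ^ s * (6 / N) ^ m ≤ 6 ^ s * (1 / 2) ^ (m + 1) := by
    calc (2 * N * a ^ s) ^ (m + 1) * N ^ s * (6 / N) ^ m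
        = (12 * a ^ s) ^ (m + 1) * N ^ s * N / 6 := by
          rw [e1, mul_pow, mul_pow 2 N, mul_pow 12,
            show (12 : ℝ) = 2 * 6 by norm_num, mul_pow 2 6]
          field_simp
      _ ≤ (12 * a ^ s) ^ (m + 1) * (6 / θ ^ (m + 1)) ^ s * (6 / θ ^ (m + 1)) / 6 := by gcongr
      _ = 6 ^ s * (12 / θ * (a / θ) ^ s) ^ (m + 1) := by
          rw [div_pow, div_pow, mul_pow, mul_pow, div_pow, div_pow, ← pow_mul, ← pow_mul,
            ← pow_mul, mul_comm s (m + 1)]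
          field_simp
      _ ≤ _ := by gcongr
  have hB : N * (E * (2 * N / 64) ^ (m + 1)) * (6 / N) ^ m ≤ 6 * E * (1 / 2) ^ (m + 1) := by
    have hq : 12 / 64 / θ ^ 2 ≤ 1 / 2 := by
      rw [div_le_iff₀ (by positivity)]
      nlinarith
    calc N * (E * (2 * N / 64) ^ (m + 1)) * (6 / N) ^ m
        = E * (12 / 64) ^ (m + 1) * N * N / 6 := by
          rw [e1, mul_div_right_comm 2 N, mul_pow,
            show (12 / 64 : ℝ) = 2 / 64 * 6 by norm_num, mul_pow (2 / 64) 6]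
          field_simp
      _ ≤ E * (12 / 64) ^ (m + 1) * (6 / θ ^ (m + 1)) * (6 / θ ^ (m + 1)) / 6 := by gcongr
      _ = 6 * E * (12 / 64 / θ ^ 2) ^ (m + 1) := by
          rw [div_pow (12 / 64 : ℝ), ← pow_mul, mul_comm 2 (m + 1), pow_mul]
          field_simp
      _ ≤ _ := by gcongr
  linarith [hA, hB]

section Integer

variable {n : ℕ}

lemma signedSum_map {R S : Type*} [Ring R] [Ring S] (f : R →+* S) (w : Fin n → R)
    (x : Fin n → Bool) : signedSum (fun i => f (w i)) x = f (signedSum w x) := by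
  simp only [signedSum, map_sum]
  refine Finset.sum_congr rfl fun i _ => ?_
  split_ifs <;> simp

lemma signedSum_intCast {M : ℕ} (w : Fin n → ℤ) (x : Fin n → Bool) :
    signedSum (fun i => (w i : ZMod M)) x = ((signedSum w x : ℤ) : ZMod M) :=
  signedSum_map (Int.castRingHom (ZMod M)) w x

lemma zeroCount_le {R : Type*} [Ring R] [DecidableEq R] (v : Fin n → R) : zeroCount v ≤ 2 ^ n := by
  refine (Finset.card_filter_le _ _).trans ?_
  simp

lemma zeroCount_intCast_eq {M : ℕ} (w : Fin n → ℤ) :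
    zeroCount (fun i => (w i : ZMod M)) = #{x : Fin n → Bool | (M : ℤ) ∣ signedSum w x} := by
  simp only [zeroCount, signedSum_intCast, ZMod.intCast_zmod_eq_zero_iff_dvd]

/-- The scale at which vanishing modulo a power of three stops being equidistributed. -/
lemma exists_threshold {θ : ℝ} (hθ : 0 < θ) {w : Fin n → ℤ}
    (hw : θ * 2 ^ n ≤ zeroCount w) :
    ∃ j : ℕ, 0 < j ∧ (3 : ℝ) ^ j ≤ 6 / θ ∧
      (2 : ℝ) * 2 ^ n ≤ 3 ^ j * zeroCount (fun i => (w i : ZMod (3 ^ j))) ∧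
      (3 : ℝ) ^ j * zeroCount (fun i => (w i : ZMod (3 ^ j))) ≤ 6 * 2 ^ n := by
  classical
  have h2n : (0 : ℝ) < 2 ^ n := by positivity
  have hle : ∀ j : ℕ, θ * 2 ^ n ≤ zeroCount (fun i => (w i : ZMod (3 ^ j))) := by
    intro j
    refine hw.trans ?_
    rw [zeroCount_intCast_eq, zeroCount]
    refine Nat.cast_le.2 (Finset.card_le_card fun x hx => ?_)
    have : signedSum w x = 0 := (Finset.mem_filter.1 hx).2
    simp [this]
  have hex : ∃ j : ℕ, (2 : ℝ) * 2 ^ n ≤ 3 ^ j * zeroCount (fun i => (w i : ZMod (3 ^ j))) := by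
    obtain ⟨j, hj⟩ := pow_unbounded_of_one_lt (2 / θ) (by norm_num : (1 : ℝ) < 3)
    refine ⟨j, ?_⟩
    have h1 : (2 : ℝ) ≤ 3 ^ j * θ := by
      rw [div_lt_iff₀ hθ] at hj; exact hj.le
    calc (2 : ℝ) * 2 ^ n ≤ 3 ^ j * θ * 2 ^ n := by gcongr
      _ = 3 ^ j * (θ * 2 ^ n) := by ring
      _ ≤ _ := by gcongr; exact hle j
  have hmin := fun m (hm : m < Nat.find hex) => Nat.find_min hex hm
  have hspec := Nat.find_spec hex
  set j := Nat.find hex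
  have hj0 : 0 < j := by
    by_contra h
    have hj : j = 0 := by omega
    rw [hj] at hspec
    have h1 : (zeroCount (fun i => (w i : ZMod (3 ^ 0))) : ℝ) ≤ 2 ^ n := by
      exact_mod_cast zeroCount_le _
    rw [pow_zero, one_mul] at hspec
    linarith
  have hprev := not_le.1 (hmin (j - 1) (by omega))
  have h3j : (3 : ℝ) ^ j = 3 * 3 ^ (j - 1) := by
    rw [← pow_succ']; congr 1; omega
  refine ⟨j, hj0, ?_, hspec, ?_⟩
  · rw [le_div_iff₀ hθ, h3j]
    have h1 : (3 : ℝ) ^ (j - 1) * (θ * 2 ^ n) < 2 * 2 ^ n :=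
      lt_of_le_of_lt (by gcongr; exact hle _) hprev
    nlinarith
  · have hmono : (zeroCount (fun i => (w i : ZMod (3 ^ j))) : ℝ) ≤
        zeroCount (fun i => (w i : ZMod (3 ^ (j - 1)))) := by
      rw [zeroCount_intCast_eq, zeroCount_intCast_eq]
      refine Nat.cast_le.2 (Finset.card_le_card fun x hx => ?_)
      refine Finset.mem_filter.2 ⟨Finset.mem_univ _, ?_⟩
      refine dvd_trans ?_ (Finset.mem_filter.1 hx).2
      exact_mod_cast pow_dvd_pow 3 (Nat.sub_le j 1)
    calc _ = 3 * (3 ^ (j - 1) * (zeroCount (fun i => (w i : ZMod (3 ^ j))) : ℝ)) := by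
          rw [h3j]; ring
      _ ≤ 3 * (3 ^ (j - 1) * zeroCount (fun i => (w i : ZMod (3 ^ (j - 1))))) := by gcongr
      _ ≤ _ := by linarith

lemma exists_primitive {w : Fin n → ℤ} (hw : w ≠ 0) :
    ∃ w' : Fin n → ℤ, (∃ i, ¬ (3 : ℤ) ∣ w' i) ∧
      ∀ x, signedSum w x = 0 ↔ signedSum w' x = 0 := by
  obtain ⟨i, hi⟩ := Function.ne_iff.1 hw
  obtain ⟨w', h1, h2⟩ := Finset.extract_gcd w (⟨i, Finset.mem_univ i⟩ : Finset.univ.Nonempty)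
  have hg : Finset.univ.gcd w ≠ 0 := fun h => hi (by rw [h1 i (Finset.mem_univ i), h]; simp)
  refine ⟨w', ?_, fun x => ?_⟩
  · by_contra! hcon
    have h3 := Finset.dvd_gcd (s := Finset.univ) (f := w') (a := 3) fun i _ => hcon i
    rw [h2] at h3
    norm_num at h3
  · have : signedSum w x = Finset.univ.gcd w * signedSum w' x := by
      rw [signedSum, signedSum, Finset.mul_sum]
      refine Finset.sum_congr rfl fun i hi => ?_
      rw [h1 i hi]
      split_ifs <;> ring
    rw [this, mul_eq_zero, or_iff_right hg]

lemma isUnit_intCast_zmod_three_pow {j : ℕ} (hj : 0 < j) (k : ℤ) :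
    IsUnit (k : ZMod (3 ^ j)) ↔ (k : ZMod 3) ≠ 0 := by
  rw [ZMod.coe_int_isUnit_iff_isCoprime, Ne, ZMod.intCast_zmod_eq_zero_iff_dvd]
  push_cast
  rw [IsCoprime.pow_left_iff hj, Prime.coprime_iff_not_dvd Int.prime_three]

/-- A nonzero vector modulo three kills at most half of the sign patterns. -/
lemma two_mul_zeroCount_le {v : Fin n → ZMod 3} (hv : v ≠ 0) : 2 * zeroCount v ≤ 2 ^ n := by
  obtain ⟨i, hi⟩ := Function.ne_iff.1 hv
  set Z : Finset (Fin n → Bool) := {x | signedSum v x = 0} with hZ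
  set flip : (Fin n → Bool) → (Fin n → Bool) := fun x => Function.update x i (!x i)
  have hflip : ∀ x, flip (flip x) = x := fun x => by simp [flip]
  have hsum : ∀ x, signedSum v (flip x) =
      signedSum v x - 2 * (if x i then v i else -v i) := by
    intro x
    rw [signedSum, signedSum, ← Finset.add_sum_erase _ _ (Finset.mem_univ i),
      ← Finset.add_sum_erase _ (fun k => if x k then v k else -v k) (Finset.mem_univ i)]
    have : ∑ k ∈ Finset.univ.erase i, (if flip x k then v k else -v k) =
        ∑ k ∈ Finset.univ.erase i, (if x k then v k else -v k) :=
      Finset.sum_congr rfl fun k hk => by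
        simp [flip, Function.update_of_ne (Finset.ne_of_mem_erase hk)]
    rw [this]
    cases hx : x i <;> simp [flip, hx] <;> ring
  have hdisj : Disjoint Z (Z.image flip) := by
    rw [Finset.disjoint_left]
    intro x hx hx'
    obtain ⟨y, hy, rfl⟩ := Finset.mem_image.1 hx'
    have h1 : signedSum v (flip y) = 0 := (Finset.mem_filter.1 hx).2
    have h2 : signedSum v y = 0 := (Finset.mem_filter.1 hy).2
    rw [hsum, h2, zero_sub, neg_eq_zero] at h1
    have h3 : (if y i then v i else -v i) = 0 :=
      (isUnit_two_of_odd (N := 3) (by decide)).mul_right_eq_zero.1 h1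
    apply hi
    split_ifs at h3
    · simpa using h3
    · simpa using h3
  have hinj : Function.Injective flip := Function.LeftInverse.injective hflip
  have h1 := Finset.card_le_univ (Z ∪ Z.image flip)
  rw [Finset.card_union_of_disjoint hdisj, Finset.card_image_of_injective _ hinj] at h1
  have h2 : zeroCount v = #Z := rfl
  simp only [Fintype.card_fun, Fintype.card_bool, Fintype.card_fin] at h1
  omega

lemma card_sparse_le (b : ℕ) :
    (#{v : Fin n → ZMod 3 | #{i | v i ≠ 0} ≤ b} : ℝ) ≤ Real.exp (3 * b) * (5 / 4) ^ n := by
  have h := card_sum_le_le_exp_mul_pow n (fun x : ZMod 3 => if x ≠ 0 then (1 : ℝ) else 0) b 3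
    (by norm_num)
  simp only [Finset.sum_boole, Nat.cast_le] at h
  refine h.trans ?_
  gcongr
  have h8 : Real.exp (-3) ≤ 1 / 8 := by
    rw [Real.exp_neg, one_div]
    apply inv_anti₀ (by norm_num)
    have h1 := Real.exp_one_gt_d9
    have h2 : Real.exp 3 = Real.exp 1 ^ 3 := by rw [← Real.exp_nat_mul]; norm_num
    rw [h2]
    calc (8 : ℝ) = 2 ^ 3 := by norm_num
      _ ≤ _ := by gcongr; linarith
  have h3 : ∑ x : ZMod 3, Real.exp (-(3 * if x ≠ 0 then (1 : ℝ) else 0)) =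
      1 + 2 * Real.exp (-3) := by
    rw [show (Finset.univ : Finset (ZMod 3)) = {0, 1, 2} by decide]
    rw [Finset.sum_insert (by decide), Finset.sum_insert (by decide), Finset.sum_singleton]
    rw [if_neg (by decide), if_pos (by decide), if_pos (by decide)]
    norm_num
    ring
  linarith

lemma card_forall_signedSum_eq_zero {R κ : Type*} [Ring R] [DecidableEq R] [Fintype κ]
    [DecidableEq κ] (v : Fin n → R) :
    #{r : κ → Fin n → Bool | ∀ k, signedSum v (r k) = 0} = zeroCount v ^ Fintype.card κ := by
  have : ({r : κ → Fin n → Bool | ∀ k, signedSum v (r k) = 0} : Finset _) =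
      Fintype.piFinset fun _ : κ => ({x | signedSum v x = 0} : Finset (Fin n → Bool)) := by
    ext r; simp
  rw [this, Fintype.card_piFinset, Finset.prod_const, Finset.card_univ, zeroCount]

end Integer

section UnionBound

variable {n : ℕ} {κ : Type*} [Fintype κ] [DecidableEq κ]

/-- A union bound over the vectors in `V` annihilated by all rows. -/
lemma card_exists_mem_forall_signedSum_eq_zero_le {R : Type*} [Ring R] [DecidableEq R]
    (V : Finset (Fin n → R)) {C : ℝ} (hC : ∀ v ∈ V, (zeroCount v : ℝ) ≤ C) :
    (#{r : κ → Fin n → Bool | ∃ v ∈ V, ∀ k, signedSum v (r k) = 0} : ℝ) ≤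
      #V * C ^ Fintype.card κ := by
  have h1 : ({r : κ → Fin n → Bool | ∃ v ∈ V, ∀ k, signedSum v (r k) = 0} : Finset _) =
      V.biUnion fun v => {r : κ → Fin n → Bool | ∀ k, signedSum v (r k) = 0} := by
    ext r; simp
  rw [h1]
  calc ((#(V.biUnion fun v => {r : κ → Fin n → Bool | ∀ k, signedSum v (r k) = 0}) : ℕ) : ℝ)
      ≤ ((∑ v ∈ V, #{r : κ → Fin n → Bool | ∀ k, signedSum v (r k) = 0} : ℕ) : ℝ) := by
        exact_mod_cast card_biUnion_le
    _ = ∑ v ∈ V, (zeroCount v : ℝ) ^ Fintype.card κ := by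
        push_cast
        exact sum_congr rfl fun v _ => by
          rw [card_forall_signedSum_eq_zero]; push_cast; rfl
    _ ≤ ∑ _v ∈ V, C ^ Fintype.card κ := by
        gcongr with v hv
        exact hC v hv
    _ = _ := by rw [sum_const, nsmul_eq_mul]

open Classical in
lemma card_exists_spread_le {N : ℕ} [NeZero N] (hN : Odd N) (hn : 0 < n)
    (hκ : Fintype.card κ = n - 1) {θ γ R : ℝ} (hγ0 : 0 < γ) (hγ1 : γ < 1) (hR : 0 ≤ R) {b s : ℕ}
    (hb : R * 64 ^ 2 ≤ b) (hs : 1 ≤ γ ^ 2 * Real.exp (γ / 2 * R) * (3 / 4 + γ / 2) ^ s)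
    (hθ : 3 / 4 ≤ θ) (hθs : 12 / θ * ((3 / 4 + γ / 2) / θ) ^ s ≤ 1 / 2)
    (hNθ : (N : ℝ) ≤ 6 / θ ^ n) :
    (#{r : κ → Fin n → Bool | ∃ v : Fin n → ZMod N, (b < #{i | IsUnit (v i)} ∧
      (2 : ℝ) * 2 ^ n ≤ N * zeroCount v ∧ (N : ℝ) * zeroCount v ≤ 6 * 2 ^ n) ∧
        ∀ k, signedSum v (r k) = 0} : ℝ) ≤
      (2 ^ n) ^ (n - 1) * ((6 ^ s + 6 * Real.exp (16 * 64 ^ 3 * R)) * (1 / 2) ^ n) := by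
  have hN1 : (1 : ℝ) ≤ N := by exact_mod_cast Nat.one_le_iff_ne_zero.2 (NeZero.ne N)
  have hN0 : (0 : ℝ) < N := by linarith
  set V : Finset (Fin n → ZMod N) := {v | b < #{i | IsUnit (v i)} ∧
      (2 : ℝ) * 2 ^ n ≤ N * zeroCount v ∧ (N : ℝ) * zeroCount v ≤ 6 * 2 ^ n} with hV
  have h1 := card_exists_mem_forall_signedSum_eq_zero_le (κ := κ) V (C := 6 * 2 ^ n / N)
    (fun v hv => by
      rw [hV, mem_filter] at hv
      rw [le_div_iff₀ hN0, mul_comm]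
      exact hv.2.2.2)
  have h2 : (#V : ℝ) ≤ (2 * N * (3 / 4 + γ / 2) ^ s) ^ n * N ^ s +
      N * (Real.exp (16 * 64 ^ 3 * R) * (2 * N / 64) ^ n) := by
    refine le_trans ?_ (card_large_zeroCount_le hN n hγ0 hγ1 hR (T := 64) (by norm_num)
      (by exact_mod_cast hb) hs)
    gcongr
    intro v hv
    rw [hV, mem_filter] at hv
    exact mem_filter.2 ⟨mem_univ _, hv.2.1, hv.2.2.1⟩
  have h3 := count_mul_pow_le (N := N) (a := 3 / 4 + γ / 2)
    (E := Real.exp (16 * 64 ^ 3 * R)) hn hN1 (by positivity) (by positivity) hθ hθs hNθ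
  have h4 : (6 * 2 ^ n / N : ℝ) ^ (n - 1) = (2 ^ n) ^ (n - 1) * (6 / N) ^ (n - 1) := by
    rw [← mul_pow]; congr 1; ring
  rw [hκ, h4] at h1
  calc _ = (#{r : κ → Fin n → Bool | ∃ v ∈ V, ∀ k, signedSum v (r k) = 0} : ℝ) := by
        simp [hV]
    _ ≤ _ := h1
    _ = (2 ^ n) ^ (n - 1) * (#V * (6 / N) ^ (n - 1)) := by ring
    _ ≤ _ := mul_le_mul_of_nonneg_left
        ((mul_le_mul_of_nonneg_right h2 (by positivity)).trans h3) (by positivity)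

open Classical in
lemma card_exists_sparse_le (hn : 0 < n) (hκ : Fintype.card κ = n - 1) (b : ℕ) :
    (#{r : κ → Fin n → Bool | ∃ v : Fin n → ZMod 3, (v ≠ 0 ∧ #{i | v i ≠ 0} ≤ b) ∧
        ∀ k, signedSum v (r k) = 0} : ℝ) ≤
      (2 ^ n) ^ (n - 1) * (2 * Real.exp (3 * b) * (5 / 8) ^ n) := by
  set V : Finset (Fin n → ZMod 3) := {v | v ≠ 0 ∧ #{i | v i ≠ 0} ≤ b} with hV
  have h1 := card_exists_mem_forall_signedSum_eq_zero_le (κ := κ) V (C := 2 ^ n / 2)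
    (fun v hv => by
      rw [hV, mem_filter] at hv
      have := two_mul_zeroCount_le hv.2.1
      rw [le_div_iff₀ (by norm_num), mul_comm]
      exact_mod_cast this)
  have h2 : (#V : ℝ) ≤ Real.exp (3 * b) * (5 / 4) ^ n := by
    refine le_trans ?_ (card_sparse_le (n := n) b)
    gcongr
    intro v hv
    rw [hV, mem_filter] at hv
    exact mem_filter.2 ⟨mem_univ _, by convert hv.2.2⟩
  obtain ⟨m, rfl⟩ : ∃ m, n = m + 1 := ⟨n - 1, by omega⟩
  rw [hκ, Nat.add_sub_cancel] at h1
  rw [Nat.add_sub_cancel]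
  calc _ = (#{r : κ → Fin (m + 1) → Bool | ∃ v ∈ V, ∀ k, signedSum v (r k) = 0} : ℝ) := by
        simp [hV]
    _ ≤ _ := h1
    _ ≤ (Real.exp (3 * b) * (5 / 4) ^ (m + 1)) * (2 ^ (m + 1) / 2) ^ m := by gcongr
    _ = _ := by
        rw [show (5 / 8 : ℝ) = 5 / 4 * (1 / 2) by norm_num, mul_pow (5 / 4 : ℝ) (1 / 2),
          div_pow (2 ^ (m + 1) : ℝ) 2, one_div, inv_pow, pow_succ (2 : ℝ) m]
        field_simp

open Classical in
lemma card_exists_large_zeroCount_le (hn : 0 < n)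
    (hκ : Fintype.card κ = n - 1) {θ γ R : ℝ} (hγ0 : 0 < γ) (hγ1 : γ < 1) (hR : 0 ≤ R) {b s : ℕ}
    (hb : R * 64 ^ 2 ≤ b) (hs : 1 ≤ γ ^ 2 * Real.exp (γ / 2 * R) * (3 / 4 + γ / 2) ^ s)
    (hθ : 3 / 4 ≤ θ) (hθs : 12 / θ * ((3 / 4 + γ / 2) / θ) ^ s ≤ 1 / 2) :
    (#{r : κ → Fin n → Bool | ∃ w : Fin n → ℤ, w ≠ 0 ∧ θ ^ n * 2 ^ n ≤ zeroCount w ∧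
        ∀ k, signedSum w (r k) = 0} : ℝ) ≤
      (2 ^ n) ^ (n - 1) * (2 * Real.exp (3 * b) * (5 / 8) ^ n +
        (n + 3) * ((6 ^ s + 6 * Real.exp (16 * 64 ^ 3 * R)) * (1 / 2) ^ n)) := by
  have hθ0 : 0 < θ := by linarith
  set K : ℝ := (6 ^ s + 6 * Real.exp (16 * 64 ^ 3 * R)) * (1 / 2) ^ n with hK
  set J : Finset ℕ := {j ∈ range (n + 3) | (3 : ℝ) ^ j ≤ 6 / θ ^ n} with hJ
  set S : Finset (κ → Fin n → Bool) := {r | ∃ v : Fin n → ZMod 3, (v ≠ 0 ∧ #{i | v i ≠ 0} ≤ b) ∧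
        ∀ k, signedSum v (r k) = 0} with hS
  set L : ℕ → Finset (κ → Fin n → Bool) := fun j => {r | ∃ v : Fin n → ZMod (3 ^ j),
    (b < #{i | IsUnit (v i)} ∧ (2 : ℝ) * 2 ^ n ≤ (3 ^ j : ℕ) * zeroCount v ∧
      ((3 ^ j : ℕ) : ℝ) * zeroCount v ≤ 6 * 2 ^ n) ∧ ∀ k, signedSum v (r k) = 0} with hL
  have hsub : ({r : κ → Fin n → Bool | ∃ w : Fin n → ℤ, w ≠ 0 ∧ θ ^ n * 2 ^ n ≤ zeroCount w ∧
        ∀ k, signedSum w (r k) = 0} : Finset _) ⊆ S ∪ J.biUnion L := by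
    intro r hr
    obtain ⟨w₀, hw₀, hz₀, hr₀⟩ := (mem_filter.1 hr).2
    obtain ⟨w, ⟨i, hi⟩, hw⟩ := exists_primitive hw₀
    have hz : θ ^ n * 2 ^ n ≤ zeroCount w := by
      have : zeroCount w = zeroCount w₀ := by
        unfold zeroCount
        congr 1; ext x; simp [hw]
      rwa [this]
    have hr1 : ∀ k, signedSum w (r k) = 0 := fun k => (hw _).1 (hr₀ k)
    rw [mem_union]
    by_cases hsp : #{i | ((w i : ℤ) : ZMod 3) ≠ 0} ≤ b
    · left
      refine mem_filter.2 ⟨mem_univ _, fun i => (w i : ZMod 3), ⟨?_, hsp⟩, fun k => ?_⟩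
      · intro h
        exact hi ((ZMod.intCast_zmod_eq_zero_iff_dvd (w i) 3).1 (congrFun h i))
      · rw [signedSum_intCast, hr1, Int.cast_zero]
    · right
      obtain ⟨j, hj0, hj, hj1, hj2⟩ := exists_threshold (θ := θ ^ n) (by positivity) hz
      rw [mem_biUnion]
      refine ⟨j, mem_filter.2 ⟨mem_range.2 ?_, hj⟩, mem_filter.2 ⟨mem_univ _,
        fun i => (w i : ZMod (3 ^ j)), ⟨?_, ?_, ?_⟩, fun k => ?_⟩⟩
      · have h6 : (6 : ℝ) / θ ^ n ≤ 6 * 3 ^ n := by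
          rw [div_le_iff₀ (by positivity), mul_assoc, ← mul_pow]
          have : (1 : ℝ) ≤ (3 * θ) ^ n := one_le_pow₀ (by linarith)
          linarith
        have h7 : (3 : ℝ) ^ j < 3 ^ (n + 3) := by
          have : (0 : ℝ) < 3 ^ n := by positivity
          rw [pow_add]
          linarith
        exact (pow_lt_pow_iff_right₀ (by norm_num)).1 h7
      · refine lt_of_lt_of_le (not_le.1 hsp) (le_of_eq ?_)
        congr 1; ext i
        simp only [mem_filter, mem_univ, true_and, isUnit_intCast_zmod_three_pow hj0]
      · push_cast; exact_mod_cast hj1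
      · push_cast; exact_mod_cast hj2
      · rw [signedSum_intCast, hr1, Int.cast_zero]
  have hLj : ∀ j ∈ J, (#(L j) : ℝ) ≤ (2 ^ n) ^ (n - 1) * K := by
    intro j hj
    have hodd : Odd (3 ^ j) := Odd.pow (by decide)
    have hjθ : ((3 ^ j : ℕ) : ℝ) ≤ 6 / θ ^ n := by
      push_cast; exact (mem_filter.1 hj).2
    exact card_exists_spread_le hodd hn hκ hγ0 hγ1 hR hb hs hθ hθs hjθ
  have hSc : (#S : ℝ) ≤ (2 ^ n) ^ (n - 1) * (2 * Real.exp (3 * b) * (5 / 8) ^ n) :=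
    card_exists_sparse_le hn hκ b
  have hJc : (#J : ℝ) ≤ n + 3 := by
    have : #J ≤ n + 3 := (card_filter_le _ _).trans (by simp)
    exact_mod_cast this
  calc _ ≤ ((#S + ∑ j ∈ J, #(L j) : ℕ) : ℝ) := by
        exact_mod_cast (card_le_card hsub).trans
          ((card_union_le _ _).trans (Nat.add_le_add_left card_biUnion_le _))
    _ ≤ (2 ^ n) ^ (n - 1) * (2 * Real.exp (3 * b) * (5 / 8) ^ n) +
        #J * ((2 ^ n) ^ (n - 1) * K) := by
        push_cast
        refine add_le_add hSc ?_
        rw [← nsmul_eq_mul]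
        exact sum_le_card_nsmul _ _ _ hLj
    _ ≤ (2 ^ n) ^ (n - 1) * (2 * Real.exp (3 * b) * (5 / 8) ^ n) +
        (n + 3) * ((2 ^ n) ^ (n - 1) * K) := by
        have : 0 ≤ K := by positivity
        gcongr
    _ = _ := by ring

end UnionBound

section Singularity

variable {n : ℕ}

/-- Fewer than `n` vectors of signs in dimension `n` have a common nonzero integer annihilator. -/
lemma exists_ne_zero_forall_signedSum_eq_zero (i : Fin n) (r : {j // j ≠ i} → Fin n → Bool) :
    ∃ w : Fin n → ℤ, w ≠ 0 ∧ ∀ k, signedSum w (r k) = 0 := by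
  set A : Matrix (Fin n) (Fin n) ℤ := Matrix.of fun j l =>
    if h : j ≠ i then (if r ⟨j, h⟩ l then (1 : ℤ) else -1) else 0 with hA
  have hdet : A.det = 0 := Matrix.det_eq_zero_of_row_eq_zero i fun l => by simp [hA]
  obtain ⟨w, hw, h⟩ := Matrix.exists_mulVec_eq_zero_iff.2 hdet
  refine ⟨w, hw, fun k => ?_⟩
  have hk := congrFun h k.1
  simp only [Matrix.mulVec, dotProduct, hA, Matrix.of_apply, dif_pos k.2, Pi.zero_apply] at hk
  rw [← hk, signedSum]
  exact sum_congr rfl fun l _ => by split_ifs <;> simp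

/-- A singular sign matrix has a row annihilated by every integer vector that annihilates the
other rows. -/
lemma exists_row_of_det_eq_zero {s : Fin n → Fin n → Bool}
    (hs : (Matrix.of fun i j => if s i j then (1 : ℝ) else -1).det = 0) :
    ∃ i, ∀ w : Fin n → ℤ, (∀ j, j ≠ i → signedSum w (s j) = 0) → signedSum w (s i) = 0 := by
  set A : Matrix (Fin n) (Fin n) ℤ := Matrix.of fun i j => if s i j then (1 : ℤ) else -1 with hA
  have hdet : A.det = 0 := by
    have h1 : (Int.castRingHom ℝ) A.det = 0 := by
      rw [RingHom.map_det, ← hs]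
      congr 1
      ext i j
      simp only [hA, RingHom.mapMatrix_apply, Matrix.map_apply, Matrix.of_apply]
      split_ifs <;> simp
    simpa using h1
  obtain ⟨y, hy, h⟩ := Matrix.exists_vecMul_eq_zero_iff.2 hdet
  obtain ⟨i, hi⟩ := Function.ne_iff.1 hy
  refine ⟨i, fun w hw => ?_⟩
  have h1 : ∀ j, (A.mulVec w) j = signedSum w (s j) := fun j => by
    simp only [Matrix.mulVec, dotProduct, hA, Matrix.of_apply, signedSum]
    exact sum_congr rfl fun l _ => by split_ifs <;> simp
  have h2 : y ⬝ᵥ (A.mulVec w) = 0 := by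
    rw [Matrix.dotProduct_mulVec, h, zero_dotProduct]
  rw [dotProduct, sum_eq_single i (fun j _ hj => by rw [h1, hw j hj, mul_zero]) (by simp), h1] at h2
  exact (mul_eq_zero.1 h2).resolve_left hi

open Classical in
lemma card_row_dependent_le (i : Fin n) {t : ℝ} (ht0 : 0 ≤ t) :
    (#{s : Fin n → Fin n → Bool | ∀ w : Fin n → ℤ, (∀ j, j ≠ i → signedSum w (s j) = 0) →
      signedSum w (s i) = 0} : ℝ) ≤
      (2 ^ n) ^ (n - 1) * t + 2 ^ n * #{r : {j // j ≠ i} → Fin n → Bool |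
        ∃ w : Fin n → ℤ, w ≠ 0 ∧ t ≤ zeroCount w ∧ ∀ k, signedSum w (r k) = 0} := by
  set B : Finset ({j // j ≠ i} → Fin n → Bool) := {r | ∃ w : Fin n → ℤ, w ≠ 0 ∧
    t ≤ zeroCount w ∧ ∀ k, signedSum w (r k) = 0} with hB
  set P : (Fin n → Bool) → ({j // j ≠ i} → Fin n → Bool) → Prop := fun x r =>
    ∀ w : Fin n → ℤ, (∀ k, signedSum w (r k) = 0) → signedSum w x = 0 with hP
  have h1 : #{s : Fin n → Fin n → Bool | ∀ w : Fin n → ℤ, (∀ j, j ≠ i → signedSum w (s j) = 0) →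
      signedSum w (s i) = 0} =
      #{p : (Fin n → Bool) × ({j // j ≠ i} → Fin n → Bool) | P p.1 p.2} := by
    refine card_equiv (Equiv.funSplitAt i _) fun s => ?_
    simp [hP, Equiv.funSplitAt, Equiv.piSplitAt]
  have h2 : #{p : (Fin n → Bool) × ({j // j ≠ i} → Fin n → Bool) | P p.1 p.2} =
      ∑ r, #{x | P x r} := by
    rw [card_filter, Fintype.sum_prod_type_right]
    exact sum_congr rfl fun r _ => (card_filter _ _).symm
  have hcard : Fintype.card (Fin n → Bool) = 2 ^ n := by simp
  have h3 : ∀ r, (#{x | P x r} : ℝ) ≤ t + if r ∈ B then 2 ^ n else 0 := by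
    intro r
    obtain ⟨w, hw, hr⟩ := exists_ne_zero_forall_signedSum_eq_zero i r
    have ht : (#{x | P x r} : ℝ) ≤ zeroCount w := by
      rw [zeroCount]
      gcongr with x
      exact fun hx => hx w hr
    by_cases hrB : r ∈ B
    · rw [if_pos hrB]
      have : (#{x | P x r} : ℝ) ≤ 2 ^ n := by
        have h4 := card_filter_le (univ : Finset (Fin n → Bool)) fun x => P x r
        rw [card_univ, hcard] at h4
        exact_mod_cast h4
      linarith
    · rw [if_neg hrB, add_zero]
      refine ht.trans (not_lt.1 fun hlt => hrB ?_)
      exact mem_filter.2 ⟨mem_univ _, w, hw, hlt.le, hr⟩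
  calc _ = ∑ r, (#{x | P x r} : ℝ) := by rw [h1, h2]; push_cast; rfl
    _ ≤ ∑ r, (t + if r ∈ B then (2 : ℝ) ^ n else 0) := sum_le_sum fun r _ => h3 r
    _ = _ := by
      rw [sum_add_distrib, sum_const, nsmul_eq_mul, card_univ, ← sum_filter, filter_mem_eq_inter,
        univ_inter, sum_const, nsmul_eq_mul, mul_comm (2 ^ n : ℝ)]
      simp

/-- An explicit bound on the number of singular sign matrices. -/
lemma card_det_eq_zero_le (hn : 0 < n) {θ γ R : ℝ} (hγ0 : 0 < γ) (hγ1 : γ < 1) (hR : 0 ≤ R)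
    {b s : ℕ} (hb : R * 64 ^ 2 ≤ b)
    (hs : 1 ≤ γ ^ 2 * Real.exp (γ / 2 * R) * (3 / 4 + γ / 2) ^ s)
    (hθ : 3 / 4 ≤ θ) (hθs : 12 / θ * ((3 / 4 + γ / 2) / θ) ^ s ≤ 1 / 2) :
    (Nat.card {s : Fin n → Fin n → Bool //
        (Matrix.of fun i j => if s i j then (1 : ℝ) else -1).det = 0} : ℝ) ≤
      2 ^ (n * n) * (n * (θ ^ n + (2 * Real.exp (3 * b) * (5 / 8) ^ n +
        (n + 3) * ((6 ^ s + 6 * Real.exp (16 * 64 ^ 3 * R)) * (1 / 2) ^ n)))) := by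
  classical
  set D : Fin n → Finset (Fin n → Fin n → Bool) := fun i => {s | ∀ w : Fin n → ℤ,
    (∀ j, j ≠ i → signedSum w (s j) = 0) → signedSum w (s i) = 0} with hD
  set F : ℝ := 2 * Real.exp (3 * b) * (5 / 8) ^ n +
    (n + 3) * ((6 ^ s + 6 * Real.exp (16 * 64 ^ 3 * R)) * (1 / 2) ^ n) with hF
  have hθ0 : 0 < θ := by linarith
  have h2n : (2 : ℝ) ^ (n * n) = 2 ^ n * (2 ^ n) ^ (n - 1) := by
    rw [← pow_succ', Nat.sub_add_cancel hn, pow_mul]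
  have hDi : ∀ i ∈ (univ : Finset (Fin n)), (#(D i) : ℝ) ≤ 2 ^ (n * n) * (θ ^ n + F) := by
    intro i _
    have h1 := card_row_dependent_le i (t := θ ^ n * 2 ^ n) (by positivity)
    have h2 := card_exists_large_zeroCount_le (κ := {j // j ≠ i}) hn (by simp) hγ0 hγ1 hR hb hs
      hθ hθs
    calc (#(D i) : ℝ) ≤ _ := h1
      _ ≤ (2 ^ n) ^ (n - 1) * (θ ^ n * 2 ^ n) + 2 ^ n * ((2 ^ n) ^ (n - 1) * F) := by gcongr
      _ = _ := by rw [h2n]; ring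
  rw [Nat.card_eq_fintype_card, Fintype.card_subtype]
  calc _ ≤ (#(univ.biUnion D) : ℝ) := by
        gcongr
        intro s hs
        obtain ⟨i, hi⟩ := exists_row_of_det_eq_zero (mem_filter.1 hs).2
        exact mem_biUnion.2 ⟨i, mem_univ _, mem_filter.2 ⟨mem_univ _, hi⟩⟩
    _ ≤ ∑ i, (#(D i) : ℝ) := by exact_mod_cast card_biUnion_le
    _ ≤ n * (2 ^ (n * n) * (θ ^ n + F)) := by
        have := sum_le_card_nsmul _ _ _ hDi
        rwa [nsmul_eq_mul, card_univ, Fintype.card_fin] at this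
    _ = _ := by ring

lemma eventually_const_mul_sq_mul_pow_le (C : ℝ) {a c : ℝ} (ha : 0 ≤ a) (hac : a < c) :
    ∀ᶠ n : ℕ in Filter.atTop, C * ((n : ℝ) ^ 2 * a ^ n) ≤ c ^ n := by
  have hc : 0 < c := ha.trans_lt hac
  have h := (tendsto_pow_const_mul_const_pow_of_abs_lt_one 2
    (r := a / c) (by rw [abs_of_nonneg (by positivity)]; exact (div_lt_one hc).2 hac)).const_mul C
  rw [mul_zero] at h
  filter_upwards [h.eventually_le_const one_pos] with n hn
  have : C * ((n : ℝ) ^ 2 * (a / c) ^ n) * c ^ n ≤ 1 * c ^ n := by gcongr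
  rwa [div_pow, one_mul, mul_assoc, mul_assoc, div_mul_cancel₀ _ (by positivity)] at this

end Singularity

/-- **Tao–Vu singularity bound.** Let `pₙ` be the probability that the `n × n` random
matrix with i.i.d. uniform `±1` entries (modeled by a uniform `s : Fin n → Fin n → Bool`)
is singular.  Then `pₙ ≤ (3/4 + o(1))ⁿ`: for every `ε > 0` there is `N` such that for
all `n ≥ N`, `pₙ ≤ (3/4 + ε)ⁿ`. -/
theorem singularity_probability_three_quarters :
    ∀ ε : ℝ, 0 < ε → ∃ N : ℕ, ∀ n : ℕ, N ≤ n →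
      (Nat.card {s : Fin n → Fin n → Bool //
          (Matrix.of fun i j => if s i j then (1 : ℝ) else -1).det = 0} : ℝ) / 2 ^ (n * n) ≤
        (3 / 4 + ε) ^ n := by
  intro ε₀ hε₀
  obtain ⟨ε, hε, hεε, hε4⟩ : ∃ ε, 0 < ε ∧ ε ≤ ε₀ ∧ ε ≤ 1 / 4 :=
    ⟨min ε₀ (1 / 4), by positivity, min_le_left _ _, min_le_right _ _⟩
  set θ : ℝ := 3 / 4 + ε / 2 with hθ
  set a : ℝ := 3 / 4 + ε / 2 / 2 with ha
  have hθ0 : 0 < θ := by positivity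
  have ha0 : 0 < a := by positivity
  obtain ⟨s, hs⟩ : ∃ s : ℕ, 12 / θ * (a / θ) ^ s ≤ 1 / 2 := by
    obtain ⟨s, hs⟩ := exists_pow_lt_of_lt_one (show (0 : ℝ) < θ / 24 by positivity)
      (show a / θ < 1 by rw [div_lt_one hθ0]; linarith)
    refine ⟨s, ?_⟩
    calc 12 / θ * (a / θ) ^ s ≤ 12 / θ * (θ / 24) := by gcongr
      _ = 1 / 2 := by field_simp; norm_num
  obtain ⟨R, hR, hRs⟩ : ∃ R : ℝ, 0 ≤ R ∧
      1 ≤ (ε / 2) ^ 2 * Real.exp (ε / 2 / 2 * R) * a ^ s := by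
    set c : ℝ := ((ε / 2) ^ 2 * a ^ s)⁻¹ with hc
    have hc0 : 0 < c := by positivity
    refine ⟨c / (ε / 2 / 2), by positivity, ?_⟩
    rw [mul_div_cancel₀ _ (by positivity)]
    calc (1 : ℝ) = (ε / 2) ^ 2 * c * a ^ s := by rw [hc]; field_simp
      _ ≤ _ := by
        gcongr
        linarith [Real.add_one_le_exp c]
  obtain ⟨b, hb⟩ := exists_nat_ge (R * 64 ^ 2)
  set A : ℝ := 2 * Real.exp (3 * b) with hA
  set E : ℝ := 6 ^ s + 6 * Real.exp (16 * 64 ^ 3 * R) with hE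
  have hA0 : 0 ≤ A := by positivity
  have hE0 : 0 ≤ E := by positivity
  obtain ⟨N, hN⟩ := Filter.eventually_atTop.1
    (eventually_const_mul_sq_mul_pow_le (1 + A + 4 * E) hθ0.le (show θ < 3 / 4 + ε by linarith))
  refine ⟨max N 1, fun n hn => ?_⟩
  have hn1 : 0 < n := (le_max_right N 1).trans hn
  have hn1' : (1 : ℝ) ≤ n := by exact_mod_cast hn1
  have h := card_det_eq_zero_le hn1 (half_pos hε) (by linarith) hR hb hRs
    (show 3 / 4 ≤ θ by linarith) hs
  rw [div_le_iff₀ (by positivity), mul_comm]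
  refine h.trans ?_
  gcongr
  calc n * (θ ^ n + (A * (5 / 8) ^ n + (n + 3) * (E * (1 / 2) ^ n)))
      ≤ n * (n * θ ^ n + (A * (n * θ ^ n) + (n + 3 * n) * (E * θ ^ n))) := by
        have h1 : θ ^ n ≤ n * θ ^ n := le_mul_of_one_le_left (by positivity) hn1'
        have h2 : (5 / 8 : ℝ) ^ n ≤ n * θ ^ n := le_trans (by gcongr; linarith) h1
        gcongr
        · linarith
        · linarith
    _ = (1 + A + 4 * E) * ((n : ℝ) ^ 2 * θ ^ n) := by ring
    _ ≤ (3 / 4 + ε) ^ n := hN n ((le_max_left N 1).trans hn)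
    _ ≤ (3 / 4 + ε₀) ^ n := by gcongr
end

section
/- Let $M_n$ be the $n \times n$ random matrix whose entries are i.i.d. random variables taking values $+1$ and $-1$ each with probability $1/2$. For every constant $A > 0$ there is a constant $B > 0$ such that for all sufficiently large $n$, $\mathbb{P}\big(M_n \text{ is singular, or } \|M_n\| \cdot \|M_n^{-1}\| \geq n^B\big) \leq n^{-A}$, where $\|\cdot\|$ denotes the operator norm with respect to the Euclidean norm on $\mathbb{R}^n$. -/
/-- The spectral (operator) norm of a real `n × n` matrix: the operator norm of the
induced linear map on Euclidean space, `‖M‖ = sup_{‖v‖ = 1} ‖M v‖`. -/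
noncomputable def specNorm {n : ℕ} (M : Matrix (Fin n) (Fin n) ℝ) : ℝ :=
  ‖LinearMap.toContinuousLinearMap (Matrix.toEuclideanLin M)‖

namespace BernoulliMatrix

/-- The sign `±1` encoded by a Boolean. -/
def sgn (b : Bool) : ℝ := if b then 1 else -1

/-- The random sum `∑ ± z j`. -/
def signSum {n : ℕ} (x : Fin n → Bool) (z : Fin n → ℝ) : ℝ := ∑ j, sgn (x j) * z j

/-- The average of `f` over a finite type. -/
noncomputable def avg {Ω : Type*} [Fintype Ω] (f : Ω → ℝ) : ℝ := (∑ ω, f ω) / Fintype.card Ω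

open Classical in
/-- The uniform probability of `P` on a finite type. -/
noncomputable def pr {Ω : Type*} [Fintype Ω] (P : Ω → Prop) : ℝ :=
  avg fun ω => if P ω then 1 else 0

section Average

variable {Ω : Type*} [Fintype Ω]

lemma avg_mono {f g : Ω → ℝ} (h : ∀ ω, f ω ≤ g ω) : avg f ≤ avg g := by
  unfold avg
  gcongr with ω _
  exact h ω

lemma avg_nonneg {f : Ω → ℝ} (h : ∀ ω, 0 ≤ f ω) : 0 ≤ avg f :=
  div_nonneg (Finset.sum_nonneg fun ω _ => h ω) (Nat.cast_nonneg _)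

lemma avg_const [Nonempty Ω] (c : ℝ) : avg (fun _ : Ω => c) = c := by
  unfold avg
  simp

lemma avg_mul_left (c : ℝ) (f : Ω → ℝ) : avg (fun ω => c * f ω) = c * avg f := by
  unfold avg
  rw [← Finset.mul_sum, mul_div_assoc]

lemma avg_add (f g : Ω → ℝ) : avg (fun ω => f ω + g ω) = avg f + avg g := by
  unfold avg
  rw [Finset.sum_add_distrib, add_div]

lemma avg_sum {ι : Type*} (s : Finset ι) (f : ι → Ω → ℝ) :
    avg (fun ω => ∑ i ∈ s, f i ω) = ∑ i ∈ s, avg (f i) := by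
  unfold avg
  rw [Finset.sum_comm, Finset.sum_div]

lemma avg_comp_equiv {Ω' : Type*} [Fintype Ω'] (e : Ω ≃ Ω') (f : Ω' → ℝ) :
    avg (fun ω => f (e ω)) = avg f := by
  unfold avg
  rw [Fintype.card_congr e, Equiv.sum_comp e f]

lemma avg_prod {Ω' : Type*} [Fintype Ω'] (f : Ω × Ω' → ℝ) :
    avg f = avg fun ω' => avg fun ω => f (ω, ω') := by
  unfold avg
  rw [Fintype.sum_prod_type_right, Fintype.card_prod, ← Finset.sum_div, div_div]
  push_cast
  ring

lemma avg_pi_prod {ι : Type*} [Fintype ι] [DecidableEq ι] (g : ι → Ω → ℝ) :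
    avg (fun s : ι → Ω => ∏ i, g i (s i)) = ∏ i, avg (g i) := by
  unfold avg
  rw [Finset.prod_div_distrib, Finset.prod_univ_sum, Fintype.piFinset_univ]
  simp

lemma pr_mono {P Q : Ω → Prop} (h : ∀ ω, P ω → Q ω) : pr P ≤ pr Q := by
  refine avg_mono fun ω => ?_
  by_cases hP : P ω
  · simp [hP, h ω hP]
  · simp only [hP, if_false]
    split_ifs <;> norm_num

lemma pr_le_avg {P : Ω → Prop} {f : Ω → ℝ} (h0 : ∀ ω, 0 ≤ f ω) (h : ∀ ω, P ω → 1 ≤ f ω) :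
    pr P ≤ avg f := by
  refine avg_mono fun ω => ?_
  split_ifs with hP
  · exact h ω hP
  · exact h0 ω

lemma pr_exists_le {ι : Type*} (s : Finset ι) (P : ι → Ω → Prop) :
    pr (fun ω => ∃ i ∈ s, P i ω) ≤ ∑ i ∈ s, pr (P i) := by
  classical
  unfold pr
  rw [← avg_sum]
  refine avg_mono fun ω => ?_
  split_ifs with h
  · obtain ⟨i, hi, hP⟩ := h
    refine le_trans ?_ (Finset.single_le_sum (fun j _ => ?_) hi)
    · simp [hP]
    · split_ifs <;> norm_num
  · exact Finset.sum_nonneg fun j _ => by split_ifs <;> norm_num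

lemma pr_or_le (P Q : Ω → Prop) : pr (fun ω => P ω ∨ Q ω) ≤ pr P + pr Q := by
  unfold pr
  rw [← avg_add]
  refine avg_mono fun ω => ?_
  by_cases hP : P ω <;> by_cases hQ : Q ω <;> simp [hP, hQ]

lemma pr_eq_card_div (P : Ω → Prop) :
    pr P = (Nat.card {ω // P ω} : ℝ) / Fintype.card Ω := by
  classical
  unfold pr avg
  rw [Finset.sum_boole, Nat.card_eq_fintype_card, Fintype.card_subtype]

lemma avg_bool (f : Bool → ℝ) : avg f = (f true + f false) / 2 := by
  unfold avg
  simp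

end Average

section Gaussian

open ProbabilityTheory MeasureTheory Real

lemma gaussianPDFReal_mul_exp_sq (b x : ℝ) :
    gaussianPDFReal 0 1 x * rexp (-b * x ^ 2) =
      (√(2 * π))⁻¹ * rexp (-((1 + 2 * b) / 2) * x ^ 2) := by
  simp only [gaussianPDFReal, NNReal.coe_one, mul_one, sub_zero]
  rw [mul_assoc, ← Real.exp_add]
  congr 2
  ring

lemma integrable_gaussian_exp_sq {b : ℝ} (hb : 0 < 1 + 2 * b) :
    Integrable (fun x => rexp (-b * x ^ 2)) (gaussianReal 0 1) := by
  rw [gaussianReal_of_var_ne_zero _ one_ne_zero,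
    integrable_withDensity_iff_integrable_smul₀' (by fun_prop) (by simp [gaussianPDF])]
  have h : (fun x => (gaussianPDF 0 1 x).toReal • rexp (-b * x ^ 2)) =
      fun x => (√(2 * π))⁻¹ * rexp (-((1 + 2 * b) / 2) * x ^ 2) := by
    funext x
    rw [toReal_gaussianPDF, smul_eq_mul, gaussianPDFReal_mul_exp_sq]
  rw [h]
  exact (integrable_exp_neg_mul_sq (by linarith)).const_mul _

lemma integral_gaussian_exp_sq {b : ℝ} (hb : 0 < 1 + 2 * b) :
    ∫ x, rexp (-b * x ^ 2) ∂gaussianReal 0 1 = 1 / √(1 + 2 * b) := by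
  rw [integral_gaussianReal_eq_integral_smul one_ne_zero]
  simp_rw [smul_eq_mul, gaussianPDFReal_mul_exp_sq]
  rw [integral_const_mul, integral_gaussian, ← Real.sqrt_inv, ← Real.sqrt_mul (by positivity),
    one_div, ← Real.sqrt_inv]
  congr 1
  field_simp

lemma integral_gaussian_cos (t : ℝ) :
    ∫ x, Real.cos (t * x) ∂gaussianReal 0 1 = rexp (-t ^ 2 / 2) := by
  have h := charFun_gaussianReal (μ := 0) (v := 1) t
  rw [charFun_apply_real] at h
  have h2 := congrArg Complex.re h
  have hi : Integrable (fun x : ℝ => Complex.exp (t * x * Complex.I)) (gaussianReal 0 1) := by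
    refine (integrable_const (1 : ℝ)).mono' (by fun_prop) (Filter.Eventually.of_forall fun x => ?_)
    rw [← Complex.ofReal_mul, Complex.norm_exp_ofReal_mul_I]
  have h3 := integral_re hi
  simp only [RCLike.re_to_complex] at h3
  rw [← h3] at h2
  convert h2 using 1
  · refine integral_congr_ae (Filter.Eventually.of_forall fun x => ?_)
    simp only
    rw [← Complex.ofReal_mul, Complex.exp_ofReal_mul_I_re]
  · rw [← Complex.ofReal_re (rexp _), Complex.ofReal_exp]
    congr 2
    push_cast
    ring

lemma integral_gaussian_exp_mul (t : ℝ) :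
    ∫ x, rexp (t * x) ∂gaussianReal 0 1 = rexp (t ^ 2 / 2) := by
  have h := mgf_gaussianReal (p := gaussianReal 0 1) (X := id) (μ := 0) (v := 1) (by simp) t
  simpa [mgf] using h

lemma abs_cos_pi_mul_le (x : ℝ) : |Real.cos (π * x)| ≤ rexp (-2 * (x - round x) ^ 2) := by
  have h1 : |Real.cos (π * x)| = |Real.cos (π * (x - round x))| := by
    rw [mul_sub, mul_comm π (round x : ℝ), Real.cos_sub_int_mul_pi, abs_mul, abs_zpow]
    simp
  have hy : |x - round x| ≤ 1 / 2 := abs_sub_round x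
  have h2 : 0 ≤ Real.cos (π * (x - round x)) := by
    apply Real.cos_nonneg_of_neg_pi_div_two_le_of_le <;>
    nlinarith [pi_pos, abs_le.1 hy]
  rw [h1, abs_of_nonneg h2]
  refine (Real.cos_le_one_sub_mul_cos_sq (x := π * (x - round x)) ?_).trans ?_
  · rw [abs_mul, abs_of_pos pi_pos]
    nlinarith [pi_pos]
  · have h3 : 2 / π ^ 2 * (π * (x - round x)) ^ 2 = 2 * (x - round x) ^ 2 := by field_simp
    have := Real.add_one_le_exp (-2 * (x - round x) ^ 2)
    linarith

end Gaussian

section SignSum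

open ProbabilityTheory MeasureTheory Real

variable {n : ℕ}

lemma signSum_smul (x : Fin n → Bool) (c : ℝ) (z : Fin n → ℝ) :
    signSum x (fun j => c * z j) = c * signSum x z := by
  unfold signSum
  rw [Finset.mul_sum]
  exact Finset.sum_congr rfl fun j _ => by ring

lemma signSum_sub (x : Fin n → Bool) (y z : Fin n → ℝ) :
    signSum x (fun j => y j - z j) = signSum x y - signSum x z := by
  unfold signSum
  rw [← Finset.sum_sub_distrib]
  exact Finset.sum_congr rfl fun j _ => by ring

lemma avg_exp_signSum (z : Fin n → ℝ) :
    avg (fun x => rexp (signSum x z)) = ∏ j, Real.cosh (z j) := by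
  have h : ∀ x : Fin n → Bool, rexp (signSum x z) = ∏ j, rexp (sgn (x j) * z j) := fun x => by
    rw [← Real.exp_sum]; rfl
  simp_rw [h]
  rw [avg_pi_prod fun j b => rexp (sgn b * z j)]
  refine Finset.prod_congr rfl fun j _ => ?_
  rw [avg_bool, Real.cosh_eq]
  simp [sgn]

lemma avg_cos_signSum (z : Fin n → ℝ) :
    avg (fun x => Real.cos (signSum x z)) = ∏ j, Real.cos (z j) := by
  have key : ∀ x : Fin n → Bool, Complex.exp (signSum x z * Complex.I) =
      ∏ j, Complex.exp (sgn (x j) * z j * Complex.I) := fun x => by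
    rw [← Complex.exp_sum, ← Finset.sum_mul]
    simp [signSum]
  have h : ∑ x : Fin n → Bool, Complex.exp (signSum x z * Complex.I) =
      ∏ j, (2 * Complex.cos (z j)) := by
    simp_rw [key]
    rw [← Fintype.piFinset_univ,
      ← Finset.prod_univ_sum (fun _ => Finset.univ)
        (fun j b => Complex.exp (sgn b * z j * Complex.I))]
    refine Finset.prod_congr rfl fun j _ => ?_
    simp [sgn, Complex.cos]
    ring_nf
  have h2 := congrArg Complex.re h
  rw [Complex.re_sum] at h2
  simp_rw [Complex.exp_ofReal_mul_I_re] at h2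
  unfold avg
  rw [h2, Finset.prod_mul_distrib]
  have : (∏ j, Complex.cos (z j)) = ((∏ j, Real.cos (z j) : ℝ) : ℂ) := by push_cast; rfl
  rw [this, Finset.prod_const, show (2 : ℂ) ^ (Finset.univ : Finset (Fin n)).card =
    ((2 ^ (Finset.univ : Finset (Fin n)).card : ℝ) : ℂ) by push_cast; rfl, Complex.re_ofReal_mul,
    Complex.ofReal_re]
  simp

/-- Squared distance to the integer lattice. -/
noncomputable def latDist (z : Fin n → ℝ) : ℝ := ∑ j, (z j - round (z j)) ^ 2

lemma latDist_nonneg (z : Fin n → ℝ) : 0 ≤ latDist z := Finset.sum_nonneg fun _ _ => sq_nonneg _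

lemma latDist_le (z : Fin n → ℝ) (p : Fin n → ℤ) : latDist z ≤ ∑ j, (z j - p j) ^ 2 := by
  refine Finset.sum_le_sum fun j _ => sq_le_sq.2 ?_
  exact round_le (z j) (p j)

lemma avg_exp_neg_signSum_sq_eq (z : Fin n → ℝ) :
    avg (fun x => rexp (-signSum x z ^ 2 / 2)) =
      ∫ g, ∏ j, Real.cos (g * z j) ∂gaussianReal 0 1 := by
  simp_rw [← avg_cos_signSum, ← integral_gaussian_cos]
  unfold avg
  rw [integral_div, integral_finsetSum]
  · congr 1
    refine Finset.sum_congr rfl fun x _ => integral_congr_ae (Filter.Eventually.of_forall fun g => ?_)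
    simp only
    rw [signSum_smul, mul_comm]
  · intro x _
    refine (integrable_const (1 : ℝ)).mono' ?_ (Filter.Eventually.of_forall fun g => ?_)
    · unfold signSum; fun_prop
    · exact abs_cos_le_one _

/-- Gaussian form of Esseen's inequality: a vector whose dilates stay away from the integer
lattice has small concentration at scale `τ`. -/
lemma avg_exp_neg_signSum_sq_le (z : Fin n → ℝ) {c a T τ : ℝ} (hc : 0 < c) (hτ : 0 < τ)
    (hT0 : 0 ≤ T) (h : ∀ θ : ℝ, |θ| ≤ T → min (c * θ ^ 2) a ≤ latDist fun j => θ * z j) :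
    avg (fun x => rexp (-signSum x z ^ 2 / (2 * τ ^ 2))) ≤
      π * τ / (2 * √c) + rexp (-2 * a) + 2 * rexp (-(π * τ * T) ^ 2 / 4) := by
  set b : ℝ := 2 * c / (π * τ) ^ 2 with hb
  have hbpos : 0 < b := by positivity
  have h1 : avg (fun x => rexp (-signSum x z ^ 2 / (2 * τ ^ 2))) =
      ∫ g, ∏ j, Real.cos (g * (τ⁻¹ * z j)) ∂gaussianReal 0 1 := by
    rw [← avg_exp_neg_signSum_sq_eq]
    congr 1
    funext x
    rw [signSum_smul]
    congr 1
    field_simp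
  have i1 : Integrable (fun g : ℝ => rexp (-b * g ^ 2)) (gaussianReal 0 1) :=
    integrable_gaussian_exp_sq (by linarith)
  have i2 : Integrable (fun g : ℝ => rexp (-(-1 / 4) * g ^ 2)) (gaussianReal 0 1) :=
    integrable_gaussian_exp_sq (by norm_num)
  have i12 : Integrable (fun g : ℝ => rexp (-b * g ^ 2) + rexp (-2 * a)) (gaussianReal 0 1) :=
    i1.add (integrable_const _)
  have hint : Integrable (fun g : ℝ => rexp (-b * g ^ 2) + rexp (-2 * a) +
      rexp (-(-1 / 4) * g ^ 2) * rexp (-(π * τ * T) ^ 2 / 4)) (gaussianReal 0 1) :=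
    i12.add (i2.mul_const _)
  have hpt : ∀ g : ℝ, ∏ j, Real.cos (g * (τ⁻¹ * z j)) ≤ rexp (-b * g ^ 2) + rexp (-2 * a) +
      rexp (-(-1 / 4) * g ^ 2) * rexp (-(π * τ * T) ^ 2 / 4) := by
    intro g
    set θ : ℝ := g / (π * τ) with hθ
    have e1 : ∏ j, Real.cos (g * (τ⁻¹ * z j)) ≤ rexp (-2 * latDist fun j => θ * z j) := by
      refine (le_abs_self _).trans ?_
      rw [Finset.abs_prod, latDist, Finset.mul_sum, Real.exp_sum]
      refine Finset.prod_le_prod (fun _ _ => abs_nonneg _) fun j _ => ?_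
      have : g * (τ⁻¹ * z j) = π * (θ * z j) := by rw [hθ]; field_simp
      rw [this]
      exact abs_cos_pi_mul_le _
    have p1 := Real.exp_pos (-b * g ^ 2)
    have p2 := Real.exp_pos (-2 * a)
    rw [← Real.exp_add]
    have p3 := Real.exp_pos (-(-1 / 4) * g ^ 2 + -(π * τ * T) ^ 2 / 4)
    by_cases hT : |θ| ≤ T
    · have e2 := h θ hT
      rcases min_le_iff.1 e2 with e3 | e3
      · have : rexp (-2 * latDist fun j => θ * z j) ≤ rexp (-b * g ^ 2) := by
          refine Real.exp_le_exp.2 ?_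
          have : b * g ^ 2 = 2 * (c * θ ^ 2) := by rw [hb, hθ]; field_simp
          linarith
        linarith
      · have : rexp (-2 * latDist fun j => θ * z j) ≤ rexp (-2 * a) :=
          Real.exp_le_exp.2 (by linarith)
        linarith
    · have e3 : rexp (-2 * latDist fun j => θ * z j) ≤ 1 :=
        Real.exp_le_one_iff.2 (by have := latDist_nonneg fun j => θ * z j; linarith)
      have e4 : 1 ≤ rexp (-(-1 / 4) * g ^ 2 + -(π * τ * T) ^ 2 / 4) := by
        refine Real.one_le_exp ?_
        have : (π * τ * T) ^ 2 ≤ g ^ 2 := by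
          have : g = π * τ * θ := by rw [hθ]; field_simp
          rw [this, mul_pow, mul_pow _ θ, ← sq_abs θ]
          push Not at hT
          gcongr
        linarith
      linarith
  rw [h1]
  have hint0 : Integrable (fun g : ℝ => ∏ j, Real.cos (g * (τ⁻¹ * z j))) (gaussianReal 0 1) := by
    refine (integrable_const (1 : ℝ)).mono' (by fun_prop) (Filter.Eventually.of_forall fun g => ?_)
    rw [Real.norm_eq_abs, Finset.abs_prod]
    exact Finset.prod_le_one (fun _ _ => abs_nonneg _) fun _ _ => abs_cos_le_one _
  refine (integral_mono hint0 hint hpt).trans ?_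
  rw [integral_add i12 (i2.mul_const _),
    integral_add i1 (integrable_const _), integral_mul_const,
    integral_gaussian_exp_sq (by linarith), integral_gaussian_exp_sq (by norm_num)]
  have f1 : 1 / √(1 + 2 * b) ≤ π * τ / (2 * √c) := by
    have : 2 * √c / (π * τ) ≤ √(1 + 2 * b) := by
      refine Real.le_sqrt_of_sq_le ?_
      rw [div_pow, mul_pow, Real.sq_sqrt hc.le, hb]
      have : 2 * (2 * c / (π * τ) ^ 2) = 2 ^ 2 * c / (π * τ) ^ 2 := by ring
      linarith
    calc 1 / √(1 + 2 * b) ≤ 1 / (2 * √c / (π * τ)) := by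
          have : 0 < √c := Real.sqrt_pos.2 hc
          gcongr
      _ = _ := by rw [one_div_div]
  have f2 : 1 / √(1 + 2 * (-1 / 4)) ≤ 2 := by
    have : (1 / 2 : ℝ) ≤ √(1 + 2 * (-1 / 4)) := Real.le_sqrt_of_sq_le (by norm_num)
    calc 1 / √(1 + 2 * (-1 / 4)) ≤ 1 / (1 / 2 : ℝ) := by gcongr
      _ = 2 := by norm_num
  have f3 : ∫ _, rexp (-2 * a) ∂gaussianReal 0 1 = rexp (-2 * a) := by simp
  rw [f3]
  gcongr

lemma avg_exp_signSum_sq_le (z : Fin n → ℝ) {b : ℝ} (hb : 0 ≤ b)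
    (h : b * ∑ j, z j ^ 2 ≤ 1 / 4) :
    avg (fun x => rexp (b * signSum x z ^ 2)) ≤ 3 / 2 := by
  have h0 : ∀ x : Fin n → Bool, rexp (b * signSum x z ^ 2) =
      ∫ g, rexp (signSum x (fun j => √(2 * b) * g * z j)) ∂gaussianReal 0 1 := by
    intro x
    have := integral_gaussian_exp_mul (√(2 * b) * signSum x z)
    rw [mul_pow, Real.sq_sqrt (by linarith)] at this
    rw [show b * signSum x z ^ 2 = 2 * b * signSum x z ^ 2 / 2 by ring, ← this]
    congr 1
    funext g
    rw [signSum_smul]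
    ring_nf
  have hi : ∀ x : Fin n → Bool, Integrable
      (fun g => rexp (signSum x (fun j => √(2 * b) * g * z j))) (gaussianReal 0 1) := by
    intro x
    have := integrable_exp_mul_gaussianReal (μ := 0) (v := 1) (√(2 * b) * signSum x z)
    convert this using 3 with g
    rw [signSum_smul]
    ring
  have h1 : avg (fun x : Fin n → Bool => rexp (b * signSum x z ^ 2)) =
      ∫ g, ∏ j, Real.cosh (√(2 * b) * g * z j) ∂gaussianReal 0 1 := by
    simp_rw [← avg_exp_signSum, h0]
    unfold avg
    rw [integral_div, integral_finsetSum _ fun x _ => hi x]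
  have hpt : ∀ g : ℝ, ∏ j, Real.cosh (√(2 * b) * g * z j) ≤ rexp (-(-1 / 4) * g ^ 2) := by
    intro g
    calc ∏ j, Real.cosh (√(2 * b) * g * z j)
        ≤ ∏ j, rexp ((√(2 * b) * g * z j) ^ 2 / 2) :=
          Finset.prod_le_prod (fun _ _ => (Real.cosh_pos _).le) fun _ _ => cosh_le_exp_half_sq _
      _ = rexp (b * (∑ j, z j ^ 2) * g ^ 2) := by
          rw [← Real.exp_sum, Finset.mul_sum, Finset.sum_mul]
          congr 1
          refine Finset.sum_congr rfl fun j _ => ?_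
          rw [mul_pow, mul_pow, Real.sq_sqrt (by linarith)]
          ring
      _ ≤ _ := by
          refine Real.exp_le_exp.2 ?_
          nlinarith [sq_nonneg g]
  have i2 : Integrable (fun g : ℝ => rexp (-(-1 / 4) * g ^ 2)) (gaussianReal 0 1) :=
    integrable_gaussian_exp_sq (by norm_num)
  rw [h1]
  refine (integral_mono_of_nonneg (Filter.Eventually.of_forall fun g =>
    Finset.prod_nonneg fun _ _ => (Real.cosh_pos _).le) i2
    (Filter.Eventually.of_forall hpt)).trans ?_
  rw [integral_gaussian_exp_sq (by norm_num)]
  have : (2 / 3 : ℝ) ≤ √(1 + 2 * (-1 / 4)) := Real.le_sqrt_of_sq_le (by norm_num)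
  calc 1 / √(1 + 2 * (-1 / 4)) ≤ 1 / (2 / 3 : ℝ) := by gcongr
    _ = 3 / 2 := by norm_num

lemma avg_sgn_mul_sgn (i j : Fin n) :
    avg (fun x : Fin n → Bool => sgn (x i) * sgn (x j)) = if i = j then 1 else 0 := by
  split_ifs with hij
  · subst hij
    have : ∀ b, sgn b * sgn b = 1 := fun b => by cases b <;> simp [sgn]
    simp_rw [this]
    exact avg_const 1
  · have h : ∀ x : Fin n → Bool, sgn (x i) * sgn (x j) =
        ∏ k, (if k = i then sgn (x k) else 1) * (if k = j then sgn (x k) else 1) := by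
      intro x
      rw [Finset.prod_mul_distrib]
      simp
    simp_rw [h]
    rw [avg_pi_prod fun k b => (if k = i then sgn b else 1) * (if k = j then sgn b else 1)]
    refine Finset.prod_eq_zero (Finset.mem_univ i) ?_
    simp [hij, avg_bool, sgn]

lemma avg_signSum_sq (z : Fin n → ℝ) : avg (fun x => signSum x z ^ 2) = ∑ j, z j ^ 2 := by
  have h : ∀ x : Fin n → Bool, signSum x z ^ 2 =
      ∑ i, ∑ j, z i * z j * (sgn (x i) * sgn (x j)) := by
    intro x
    rw [sq, signSum, Finset.sum_mul_sum]
    exact Finset.sum_congr rfl fun i _ => Finset.sum_congr rfl fun j _ => by ring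
  simp_rw [h]
  rw [avg_sum]
  simp_rw [avg_sum, avg_mul_left, avg_sgn_mul_sgn]
  simp [sq]

lemma avg_exp_neg_signSum_sq_le_of_pos (z : Fin n → ℝ) {w : ℝ} (hw : ∑ j, z j ^ 2 = w)
    (hpos : 0 < w) : avg (fun x => rexp (-signSum x z ^ 2 / (8 * w))) ≤ rexp (-1 / 16) := by
  have h1 := avg_exp_signSum_sq_le z (b := 1 / (4 * w)) (by positivity)
    (by rw [hw]; field_simp; norm_num)
  have h2 : ∀ x : Fin n → Bool, rexp (-signSum x z ^ 2 / (8 * w)) ≤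
      3 / 4 + (-3 / (16 * w)) * signSum x z ^ 2 + 1 / 4 * rexp (1 / (4 * w) * signSum x z ^ 2) := by
    intro x
    set y : ℝ := signSum x z ^ 2 / (8 * w) with hy
    have hy0 : 0 ≤ y := by positivity
    have e1 : -signSum x z ^ 2 / (8 * w) = -y := by rw [hy]; ring
    have e2 : 1 / (4 * w) * signSum x z ^ 2 = 2 * y := by rw [hy]; field_simp; ring
    have e3 : (-3 / (16 * w)) * signSum x z ^ 2 = -(3 / 2) * y := by rw [hy]; field_simp; ring
    rw [e1, e2, e3]
    have q1 := Real.quadratic_le_exp_of_nonneg (x := 2 * y) (by linarith)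
    have q2 := Real.quadratic_le_exp_of_nonneg hy0
    have q3 : rexp (-y) ≤ 1 / (1 + y + y ^ 2 / 2) := by
      rw [Real.exp_neg, ← one_div]
      gcongr
    refine q3.trans ?_
    rw [div_le_iff₀ (by positivity)]
    nlinarith [mul_nonneg hy0 hy0, mul_nonneg hy0 (mul_nonneg hy0 hy0), sq_nonneg (y ^ 2)]
  refine (avg_mono h2).trans ?_
  rw [avg_add, avg_add, avg_const, avg_mul_left, avg_mul_left, avg_signSum_sq, hw]
  have : -3 / (16 * w) * w = -3 / 16 := by field_simp
  rw [this]
  have := Real.add_one_le_exp (-1 / 16 : ℝ)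
  linarith

end SignSum

section Lattice

open Real

variable {n : ℕ}

/-- Integer points of the `ℓ¹` ball of radius `L`. -/
noncomputable def latticeBall (n L : ℕ) : Finset (Fin n → ℤ) :=
  {p ∈ Fintype.piFinset fun _ => Finset.Icc (-(L : ℤ)) L | ∑ j, (p j).natAbs ≤ L}

lemma mem_latticeBall {L : ℕ} {p : Fin n → ℤ} :
    p ∈ latticeBall n L ↔ ∑ j, (p j).natAbs ≤ L := by
  simp only [latticeBall, Finset.mem_filter, Fintype.mem_piFinset, Finset.mem_Icc, and_iff_right_iff_imp]
  intro h j
  have := (Finset.single_le_sum (f := fun j => (p j).natAbs) (fun _ _ => Nat.zero_le _)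
    (Finset.mem_univ j)).trans h
  omega

lemma sum_pow_natAbs_le {x : ℝ} (hx0 : 0 ≤ x) (hx1 : x < 1) (L : ℕ) :
    ∑ k ∈ Finset.Icc (-(L : ℤ)) L, x ^ k.natAbs ≤ (1 + x) / (1 - x) := by
  have h : ∀ L : ℕ, ∑ k ∈ Finset.Icc (-(L : ℤ)) L, x ^ k.natAbs =
      2 * (∑ i ∈ Finset.range (L + 1), x ^ i) - 1 := by
    intro L
    induction L with
    | zero => simp; norm_num
    | succ L ih =>
      have : Finset.Icc (-((L + 1 : ℕ) : ℤ)) ((L + 1 : ℕ) : ℤ) =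
          insert (-((L + 1 : ℕ) : ℤ)) (insert ((L + 1 : ℕ) : ℤ) (Finset.Icc (-(L : ℤ)) L)) := by
        ext k
        simp only [Finset.mem_insert, Finset.mem_Icc]
        omega
      rw [this, Finset.sum_insert, Finset.sum_insert, ih, Finset.sum_range_succ _ (L + 1),
        Int.natAbs_neg, Int.natAbs_natCast]
      · ring
      · simp only [Finset.mem_Icc]; omega
      · simp only [Finset.mem_insert, Finset.mem_Icc]; omega
  have hg : ∑ i ∈ Finset.range (L + 1), x ^ i ≤ 1 / (1 - x) := by
    rw [one_div]
    exact (summable_geometric_of_lt_one hx0 hx1).sum_le_tsum _ (fun i _ => by positivity) |>.trans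
      (tsum_geometric_of_lt_one hx0 hx1).le
  rw [h]
  have : (1 + x) / (1 - x) = 2 * (1 / (1 - x)) - 1 := by
    have : 1 - x ≠ 0 := by linarith
    field_simp
    ring
  linarith

lemma card_latticeBall_mul_pow_le {x : ℝ} (hx0 : 0 ≤ x) (hx1 : x < 1) (L : ℕ) :
    ((latticeBall n L).card : ℝ) * x ^ L ≤ ((1 + x) / (1 - x)) ^ n := by
  calc ((latticeBall n L).card : ℝ) * x ^ L = ∑ p ∈ latticeBall n L, x ^ L := by simp
    _ ≤ ∑ p ∈ latticeBall n L, ∏ j, x ^ (p j).natAbs := by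
        refine Finset.sum_le_sum fun p hp => ?_
        rw [Finset.prod_pow_eq_pow_sum]
        exact pow_le_pow_of_le_one hx0 hx1.le (mem_latticeBall.1 hp)
    _ ≤ ∑ p ∈ Fintype.piFinset fun _ : Fin n => Finset.Icc (-(L : ℤ)) L,
          ∏ j, x ^ (p j).natAbs :=
        Finset.sum_le_sum_of_subset_of_nonneg (Finset.filter_subset _ _)
          fun _ _ _ => Finset.prod_nonneg fun _ _ => by positivity
    _ = ∏ _j : Fin n, ∑ k ∈ Finset.Icc (-(L : ℤ)) L, x ^ k.natAbs :=
        (Finset.prod_univ_sum (fun _ => Finset.Icc (-(L : ℤ)) L) fun _ k => x ^ k.natAbs).symm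
    _ ≤ ∏ _j : Fin n, (1 + x) / (1 - x) :=
        Finset.prod_le_prod (fun _ _ => Finset.sum_nonneg fun _ _ => by positivity)
          fun _ _ => sum_pow_natAbs_le hx0 hx1 L
    _ = _ := by rw [Finset.prod_const, Finset.card_univ, Fintype.card_fin]

lemma card_latticeBall_le (hn : 0 < n) (L : ℕ) :
    ((latticeBall n L).card : ℝ) ≤ (rexp 1 * (1 + 2 * L / n)) ^ n := by
  rcases Nat.eq_zero_or_pos L with rfl | hL
  · have h := card_latticeBall_mul_pow_le (n := n) (x := 0) le_rfl one_pos 0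
    have : (1 : ℝ) ≤ rexp 1 ^ n := one_le_pow₀ (Real.one_le_exp zero_le_one)
    simp only [pow_zero, mul_one, add_zero, sub_zero, div_one, one_pow] at h
    simpa using h.trans this
  set l : ℝ := n / L with hl
  have hn' : (0 : ℝ) < n := by exact_mod_cast hn
  have hL' : (0 : ℝ) < L := by exact_mod_cast hL
  have hlpos : 0 < l := by positivity
  have hx1 : rexp (-l) < 1 := by rw [← Real.exp_zero]; exact Real.exp_lt_exp.2 (by linarith)
  have h := card_latticeBall_mul_pow_le (n := n) (Real.exp_pos (-l)).le hx1 L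
  have h1 : rexp (-l) ^ L = rexp (-n) := by
    rw [← Real.exp_nat_mul, hl]
    congr 1
    field_simp
  have h2 : (1 + rexp (-l)) / (1 - rexp (-l)) ≤ 1 + 2 * L / n := by
    have e1 := Real.add_one_le_exp l
    have e2 : rexp (-l) ≤ 1 / (1 + l) := by
      rw [Real.exp_neg, ← one_div, add_comm]
      gcongr
    have e3 : rexp (-l) * (1 + l) ≤ 1 := by rwa [le_div_iff₀ (by linarith)] at e2
    have e4 : (1 + 2 * L / n : ℝ) = 1 + 2 / l := by rw [hl]; field_simp
    rw [e4, div_le_iff₀ (by linarith)]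
    have e5 : (1 + 2 / l) * (1 - rexp (-l)) = 1 + rexp (-l) +
      2 / l * (1 - rexp (-l) * (1 + l)) := by field_simp; ring
    have e6 : 0 ≤ 2 / l * (1 - rexp (-l) * (1 + l)) := mul_nonneg (by positivity) (by linarith)
    linarith
  rw [h1] at h
  have h3 : ((latticeBall n L).card : ℝ) = (latticeBall n L).card * rexp (-n) * rexp n := by
    rw [mul_assoc, ← Real.exp_add]; simp
  rw [h3, mul_pow, ← Real.exp_nat_mul, mul_one, mul_comm]
  gcongr
  refine h.trans ?_
  gcongr

end Lattice

section Rounding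

variable {n : ℕ}

lemma exists_rounding_step {ι : Type*} [Fintype ι] (V c : ι → ℝ) (y : ℝ) :
    ∃ q : ℤ, |q - y| ≤ 1 ∧
      ∑ i, (V i + c i * (q - y)) ^ 2 ≤ ∑ i, V i ^ 2 + (∑ i, c i ^ 2) / 4 := by
  set f := Int.fract y with hf
  have hf0 : 0 ≤ f := Int.fract_nonneg y
  have hf1 : f < 1 := Int.fract_lt_one y
  have hy : (⌊y⌋ : ℝ) - y = -f := by rw [hf, Int.fract]; ring
  have hexp : ∀ t : ℝ, ∑ i, (V i + c i * t) ^ 2 =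
      ∑ i, V i ^ 2 + 2 * t * (∑ i, V i * c i) + t ^ 2 * ∑ i, c i ^ 2 := by
    intro t
    rw [Finset.mul_sum, Finset.mul_sum, ← Finset.sum_add_distrib, ← Finset.sum_add_distrib]
    exact Finset.sum_congr rfl fun i _ => by ring
  have hc : 0 ≤ ∑ i, c i ^ 2 := Finset.sum_nonneg fun _ _ => sq_nonneg _
  by_contra! hcon
  have h1 := hcon ⌊y⌋ (by rw [hy, abs_neg, abs_of_nonneg hf0]; exact hf1.le)
  have h2 := hcon (⌊y⌋ + 1) (by
    push_cast
    rw [show (⌊y⌋ : ℝ) + 1 - y = 1 - f by linarith, abs_of_nonneg (by linarith)]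
    linarith)
  rw [hexp, hy] at h1
  push_cast at h2
  rw [hexp, show (⌊y⌋ : ℝ) + 1 - y = 1 - f by linarith] at h2
  set S := ∑ i, V i * c i
  set C := ∑ i, c i ^ 2
  have k1 : C / 4 < -2 * f * S + f ^ 2 * C := by linarith
  have k2 : C / 4 < 2 * (1 - f) * S + (1 - f) ^ 2 * C := by linarith
  have k3 : (1 - f) * (C / 4) + f * (C / 4) <
      (1 - f) * (-2 * f * S + f ^ 2 * C) + f * (2 * (1 - f) * S + (1 - f) ^ 2 * C) := by
    have a1 := mul_lt_mul_of_pos_left k1 (show 0 < 1 - f by linarith)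
    have a2 := mul_le_mul_of_nonneg_left k2.le hf0
    linarith
  have k4 : (1 - f) * (-2 * f * S + f ^ 2 * C) + f * (2 * (1 - f) * S + (1 - f) ^ 2 * C) =
    f * (1 - f) * C := by ring
  nlinarith [mul_nonneg hc (sq_nonneg (f - 1 / 2))]

/-- Every real vector has an integer rounding whose error is almost annihilated by a given
sign matrix (derandomized unbiased rounding). -/
lemma exists_rounding (s : Fin n → Fin n → Bool) (y : Fin n → ℝ) :
    ∃ q : Fin n → ℤ, (∀ j, |q j - y j| ≤ 1) ∧
      ∑ i, signSum (s i) (fun j => q j - y j) ^ 2 ≤ (n : ℝ) * n / 4 := by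
  classical
  have h : ∀ J : Finset (Fin n), ∃ q : Fin n → ℤ, (∀ j ∈ J, |q j - y j| ≤ 1) ∧
      ∑ i, (∑ j ∈ J, sgn (s i j) * (q j - y j)) ^ 2 ≤ (J.card : ℝ) * n / 4 := by
    intro J
    induction J using Finset.induction_on with
    | empty => exact ⟨0, by simp, by simp⟩
    | insert a J ha ih =>
      obtain ⟨q, hq, hs⟩ := ih
      obtain ⟨m, hm, hms⟩ := exists_rounding_step
        (fun i => ∑ j ∈ J, sgn (s i j) * (q j - y j)) (fun i => sgn (s i a)) (y a)
      have hne : ∀ j ∈ J, Function.update q a m j = q j := fun j hj =>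
        Function.update_of_ne (by rintro rfl; exact ha hj) _ _
      refine ⟨Function.update q a m, fun j hj => ?_, ?_⟩
      · rcases Finset.mem_insert.1 hj with rfl | hj
        · simpa using hm
        · rw [hne j hj]; exact hq j hj
      · have e1 : ∀ i, ∑ j ∈ insert a J, sgn (s i j) * (Function.update q a m j - y j) =
            ∑ j ∈ J, sgn (s i j) * (q j - y j) + sgn (s i a) * (m - y a) := by
          intro i
          rw [Finset.sum_insert ha, Function.update_self, add_comm]
          congr 1
          exact Finset.sum_congr rfl fun j hj => by rw [hne j hj]
        simp_rw [e1]
        have e2 : ∑ i, sgn (s i a) ^ 2 = (n : ℝ) := by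
          have : ∀ b, sgn b ^ 2 = 1 := fun b => by cases b <;> simp [sgn]
          simp [this]
        rw [Finset.card_insert_of_notMem ha]
        push_cast
        rw [e2] at hms
        linarith
  obtain ⟨q, hq, hs⟩ := h Finset.univ
  refine ⟨q, fun j => hq j (Finset.mem_univ j), ?_⟩
  simpa [signSum] using hs

end Rounding

section OperatorNorm

open Real

variable {n : ℕ}

lemma sum_natAbs_le_sum_sq (p : Fin n → ℤ) :
    ((∑ j, (p j).natAbs : ℕ) : ℝ) ≤ ∑ j, (p j : ℝ) ^ 2 := by
  push_cast
  refine Finset.sum_le_sum fun j _ => ?_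
  rw [Nat.cast_natAbs, Int.cast_abs, ← sq_abs]
  rcases eq_or_ne (p j) 0 with h | h
  · simp [h]
  · have : (1 : ℝ) ≤ |(p j : ℝ)| := by exact_mod_cast Int.one_le_abs h
    nlinarith

lemma sq_sum_natAbs_le (p : Fin n → ℤ) :
    ((∑ j, (p j).natAbs : ℕ) : ℝ) ^ 2 ≤ n * ∑ j, (p j : ℝ) ^ 2 := by
  have h := sq_sum_le_card_mul_sum_sq (s := (Finset.univ : Finset (Fin n)))
    (f := fun j => |(p j : ℝ)|)
  simp only [sq_abs, Finset.card_univ, Fintype.card_fin] at h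
  push_cast
  simpa [Nat.cast_natAbs, Int.cast_abs] using h

/-- Chernoff bound for the rows of a random sign matrix, restricted to a set of rows. -/
lemma pr_sum_sq_le (J : Finset (Fin n)) (z : Fin n → ℝ) {b R ρ : ℝ} (hb : 0 ≤ b)
    (h : avg (fun x => rexp (-signSum x z ^ 2 * b)) ≤ ρ) :
    pr (fun s : Fin n → Fin n → Bool => ∑ k ∈ J, signSum (s k) z ^ 2 ≤ R) ≤
      rexp (b * R) * ρ ^ J.card := by
  classical
  have h1 : pr (fun s : Fin n → Fin n → Bool => ∑ k ∈ J, signSum (s k) z ^ 2 ≤ R) ≤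
      avg fun s : Fin n → Fin n → Bool => rexp (b * R) *
        ∏ k, if k ∈ J then rexp (-signSum (s k) z ^ 2 * b) else 1 := by
    refine pr_le_avg (fun s => ?_) fun s hs => ?_
    · exact mul_nonneg (Real.exp_pos _).le (Finset.prod_nonneg fun k _ => by
        split_ifs <;> positivity)
    · rw [Finset.prod_ite_mem, Finset.univ_inter, ← Real.exp_sum, ← Real.exp_add]
      refine Real.one_le_exp ?_
      rw [← Finset.sum_mul, Finset.sum_neg_distrib]
      nlinarith
  refine h1.trans ?_
  rw [avg_mul_left, avg_pi_prod fun k x => if k ∈ J then rexp (-signSum x z ^ 2 * b) else 1]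
  have h2 : ∀ k, avg (fun x : Fin n → Bool => if k ∈ J then rexp (-signSum x z ^ 2 * b) else 1) =
      if k ∈ J then avg (fun x : Fin n → Bool => rexp (-signSum x z ^ 2 * b)) else 1 := by
    intro k
    split_ifs
    · rfl
    · exact avg_const 1
  simp_rw [h2]
  rw [Finset.prod_ite_mem, Finset.univ_inter, Finset.prod_const]
  gcongr
  exact avg_nonneg fun x => (Real.exp_pos _).le

lemma pr_le_sum_sq (z : Fin n → ℝ) (hn : 0 < n) (hz : ∑ j, z j ^ 2 ≤ 4 * n) {R : ℝ} :
    pr (fun s : Fin n → Fin n → Bool => R ≤ ∑ k, signSum (s k) z ^ 2) ≤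
      rexp (-(R / (16 * n))) * (3 / 2) ^ n := by
  have hn' : (0 : ℝ) < n := by exact_mod_cast hn
  have h := avg_exp_signSum_sq_le z (b := 1 / (16 * n)) (by positivity) (by
    rw [one_div, inv_mul_le_iff₀ (by positivity)]; linarith)
  have h1 : pr (fun s : Fin n → Fin n → Bool => R ≤ ∑ k, signSum (s k) z ^ 2) ≤
      avg fun s : Fin n → Fin n → Bool => rexp (-(R / (16 * n))) *
        ∏ k, rexp (1 / (16 * n) * signSum (s k) z ^ 2) := by
    refine pr_le_avg (fun s => by positivity) fun s hs => ?_
    rw [← Real.exp_sum, ← Real.exp_add, ← Finset.mul_sum]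
    refine Real.one_le_exp ?_
    have : R / (16 * n) ≤ 1 / (16 * n) * ∑ k, signSum (s k) z ^ 2 := by
      rw [one_div, inv_mul_eq_div]; gcongr
    linarith
  refine h1.trans ?_
  rw [avg_mul_left, avg_pi_prod fun _ x => rexp (1 / (16 * n) * signSum x z ^ 2),
    Finset.prod_const, Finset.card_univ, Fintype.card_fin]
  gcongr
  exact avg_nonneg fun x => (Real.exp_pos _).le

/-- The sign matrix `s` has operator norm at most `9 √n`. -/
def OpBounded (s : Fin n → Fin n → Bool) : Prop :=
  ∀ z : Fin n → ℝ, ∑ k, signSum (s k) z ^ 2 ≤ 81 * n * ∑ j, z j ^ 2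

lemma opBounded_of_lattice (hn : 0 < n) (s : Fin n → Fin n → Bool)
    (h : ∀ q ∈ latticeBall n (2 * n), ∑ j, (q j : ℝ) ^ 2 ≤ 4 * n →
      ∑ k, signSum (s k) (fun j => q j) ^ 2 ≤ 64 * n ^ 2) : OpBounded s := by
  intro z
  have hn' : (0 : ℝ) < n := by exact_mod_cast hn
  have hz0 : 0 ≤ ∑ j, z j ^ 2 := Finset.sum_nonneg fun _ _ => sq_nonneg _
  rcases hz0.eq_or_lt with hz | hz
  · have hzero : ∀ j, z j = 0 := fun j => by
      have := (Finset.sum_eq_zero_iff_of_nonneg fun j _ => sq_nonneg (z j)).1 hz.symm j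
        (Finset.mem_univ j)
      exact pow_eq_zero_iff two_ne_zero |>.1 this
    simp [signSum, hzero]
  set w := ∑ j, z j ^ 2 with hw
  set r := √(n / w) with hr
  have hr2 : r ^ 2 = n / w := Real.sq_sqrt (by positivity)
  have hy : ∑ j, (r * z j) ^ 2 = n := by
    simp_rw [mul_pow]
    rw [← Finset.mul_sum, ← hw, hr2]
    field_simp
  obtain ⟨q, hq1, hq2⟩ := exists_rounding s fun j => r * z j
  have hq3 : ∑ j, (q j : ℝ) ^ 2 ≤ 4 * n := by
    have : ∀ j, (q j : ℝ) ^ 2 ≤ 2 * (r * z j) ^ 2 + 2 := fun j => by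
      have : (q j - r * z j) ^ 2 ≤ 1 := (sq_le_one_iff_abs_le_one _).2 (hq1 j)
      nlinarith [sq_nonneg (q j - r * z j - r * z j)]
    refine (Finset.sum_le_sum fun j _ => this j).trans ?_
    rw [Finset.sum_add_distrib, ← Finset.mul_sum, hy]
    simp
    linarith
  have hmem : q ∈ latticeBall n (2 * n) := by
    rw [mem_latticeBall]
    have h1 := sq_sum_natAbs_le q
    have h2 : ((∑ j, (q j).natAbs : ℕ) : ℝ) ^ 2 ≤ ((2 * n : ℕ) : ℝ) ^ 2 := by
      refine h1.trans ?_
      push_cast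
      nlinarith
    exact_mod_cast (sq_le_sq₀ (Nat.cast_nonneg _) (Nat.cast_nonneg _)).1 h2
  have hs := h q hmem hq3
  have hrow : ∀ k, r ^ 2 * signSum (s k) z ^ 2 ≤ 9 / 8 * signSum (s k) (fun j => q j) ^ 2 +
      9 * signSum (s k) (fun j => q j - r * z j) ^ 2 := by
    intro k
    rw [signSum_sub, ← mul_pow, ← signSum_smul]
    set a := signSum (s k) fun j => (q j : ℝ)
    set b := signSum (s k) fun j => r * z j
    nlinarith [sq_nonneg (9 * a - 8 * b)]
  have hsum := Finset.sum_le_sum fun k (_ : k ∈ Finset.univ) => hrow k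
  rw [← Finset.mul_sum, Finset.sum_add_distrib, ← Finset.mul_sum, ← Finset.mul_sum, hr2] at hsum
  have : n / w * ∑ k, signSum (s k) z ^ 2 ≤ 81 * n ^ 2 := by nlinarith
  rw [div_mul_eq_mul_div, div_le_iff₀ hz] at this
  refine le_of_mul_le_mul_left (this.trans (le_of_eq ?_)) hn'
  ring

lemma pr_not_opBounded_le (hn : 0 < n) :
    pr (fun s : Fin n → Fin n → Bool => ¬ OpBounded s) ≤ (1 / 2) ^ n := by
  classical
  have hn' : (0 : ℝ) < n := by exact_mod_cast hn
  set Q := (latticeBall n (2 * n)).filter fun q => ∑ j, (q j : ℝ) ^ 2 ≤ 4 * n with hQ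
  have h1 : pr (fun s : Fin n → Fin n → Bool => ¬ OpBounded s) ≤
      pr fun s : Fin n → Fin n → Bool =>
        ∃ q ∈ Q, 64 * (n : ℝ) ^ 2 ≤ ∑ k, signSum (s k) (fun j => q j) ^ 2 := by
    refine pr_mono fun s hs => ?_
    by_contra! hcon
    exact hs (opBounded_of_lattice hn s fun q hq hq2 =>
      (hcon q (Finset.mem_filter.2 ⟨hq, hq2⟩)).le)
  refine h1.trans ((pr_exists_le _ _).trans ?_)
  have h2 : ∀ q ∈ Q, pr (fun s : Fin n → Fin n → Bool =>
      64 * (n : ℝ) ^ 2 ≤ ∑ k, signSum (s k) (fun j => q j) ^ 2) ≤ (1 / 24) ^ n := by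
    intro q hq
    refine (pr_le_sum_sq _ hn (Finset.mem_filter.1 hq).2).trans ?_
    have e1 : -(64 * (n : ℝ) ^ 2 / (16 * n)) = n * (-4) := by field_simp; norm_num
    rw [e1, Real.exp_nat_mul, ← mul_pow]
    refine pow_le_pow_left₀ (by positivity) ?_ n
    have e2 : (36 : ℝ) ≤ rexp 4 := by
      have : (2.7 : ℝ) ^ 4 ≤ rexp 1 ^ 4 :=
        pow_le_pow_left₀ (by norm_num) (by linarith [Real.exp_one_gt_d9]) 4
      rw [← Real.exp_nat_mul] at this
      norm_num at this ⊢
      linarith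
    rw [Real.exp_neg]
    have : (rexp 4)⁻¹ ≤ (36 : ℝ)⁻¹ := inv_anti₀ (by norm_num) e2
    linarith
  refine (Finset.sum_le_sum h2).trans ?_
  rw [Finset.sum_const, nsmul_eq_mul]
  have h3 := card_latticeBall_mul_pow_le (n := n) (x := 1 / 2) (by norm_num) (by norm_num) (2 * n)
  have h4 : (Q.card : ℝ) ≤ (latticeBall n (2 * n)).card := by
    exact_mod_cast Finset.card_filter_le _ _
  have h5 : ((latticeBall n (2 * n)).card : ℝ) ≤ 12 ^ n := by
    rw [pow_mul] at h3
    have : ((1 + 1 / 2 : ℝ) / (1 - 1 / 2)) ^ n = 12 ^ n * ((1 / 2) ^ 2) ^ n := by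
      rw [← mul_pow]; norm_num
    rw [this] at h3
    exact le_of_mul_le_mul_right h3 (by positivity)
  calc (Q.card : ℝ) * (1 / 24) ^ n ≤ 12 ^ n * (1 / 24) ^ n := by gcongr; exact h4.trans h5
    _ = (1 / 2) ^ n := by rw [← mul_pow]; norm_num

end OperatorNorm

section Structure

open Real

variable {n : ℕ}

/-- The dilates `θ z`, `|θ| ≤ T`, stay away from the integer lattice. -/
def Spread (c a T : ℝ) (z : Fin n → ℝ) : Prop :=
  ∀ θ : ℝ, |θ| ≤ T → min (c * θ ^ 2) a ≤ latDist fun j => θ * z j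

lemma latDist_abs_mul_le (θ : ℝ) (z : Fin n → ℝ) :
    latDist (fun j => |θ| * z j) ≤ latDist fun j => θ * z j := by
  rcases abs_choice θ with h | h
  · rw [h]
  · rw [h]
    refine (latDist_le _ fun j => -round (θ * z j)).trans (le_of_eq ?_)
    refine Finset.sum_congr rfl fun j _ => ?_
    push_cast
    ring

lemma latDist_mul_of_lt {θ : ℝ} (hθ0 : 0 ≤ θ) (hθ : θ < 1 / 2) {z : Fin n → ℝ}
    (hz : ∑ j, z j ^ 2 = 1) : latDist (fun j => θ * z j) = θ ^ 2 := by
  have h : ∀ j, round (θ * z j) = 0 := fun j => by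
    have h1 : z j ^ 2 ≤ 1 := hz ▸ Finset.single_le_sum (f := fun j => z j ^ 2)
      (fun _ _ => sq_nonneg _) (Finset.mem_univ j)
    have h2 := abs_le.1 ((sq_le_one_iff_abs_le_one _).1 h1)
    rw [round_eq, Int.floor_eq_zero_iff, Set.mem_Ico]
    constructor <;> nlinarith
  simp only [latDist, h, Int.cast_zero, sub_zero, mul_pow]
  rw [← Finset.mul_sum, hz, mul_one]

lemma exists_almost_first_failure {c a T : ℝ} (hc : c ≤ 1) {z : Fin n → ℝ}
    (hz : ∑ j, z j ^ 2 = 1) (h : ¬ Spread c a T z) :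
    ∃ θ₀ : ℝ, 0 < θ₀ ∧ θ₀ ≤ T ∧ latDist (fun j => θ₀ * z j) < min (c * θ₀ ^ 2) a ∧
      Spread c a (θ₀ / 4) z := by
  set F : Set ℝ := {θ | 0 < θ ∧ θ ≤ T ∧ latDist (fun j => θ * z j) < min (c * θ ^ 2) a} with hF
  have habs : ∀ θ : ℝ, |θ| ≤ T → latDist (fun j => θ * z j) < min (c * θ ^ 2) a → |θ| ∈ F := by
    intro θ hθ hlt
    refine ⟨abs_pos.2 ?_, hθ, ?_⟩
    · rintro rfl
      have h1 := hlt.trans_le (min_le_left _ _)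
      rw [zero_pow two_ne_zero, mul_zero] at h1
      exact absurd h1 (not_lt.2 (latDist_nonneg _))
    · rw [sq_abs]
      exact (latDist_abs_mul_le θ z).trans_lt hlt
  have hne : F.Nonempty := by
    unfold Spread at h
    push Not at h
    obtain ⟨θ, hθ, hlt⟩ := h
    exact ⟨_, habs θ hθ hlt⟩
  have hlow : ∀ θ ∈ F, 1 / 2 ≤ θ := by
    intro θ hθ
    by_contra! hlt
    have h1 := hθ.2.2.trans_le (min_le_left _ _)
    rw [latDist_mul_of_lt hθ.1.le hlt hz] at h1
    nlinarith [sq_nonneg θ]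
  have hs : 1 / 2 ≤ sInf F := le_csInf hne hlow
  obtain ⟨θ₀, hθ₀, hlt⟩ := exists_lt_of_csInf_lt hne (show sInf F < 2 * sInf F by linarith)
  refine ⟨θ₀, hθ₀.1, hθ₀.2.1, hθ₀.2.2, fun θ hθ => ?_⟩
  by_contra! hcon
  have hpos := hθ₀.1
  have h1 := csInf_le ⟨1 / 2, hlow⟩ (habs θ (by linarith [hθ₀.2.1]) hcon)
  linarith

lemma signSum_sq_eq_of_orthogonal {x : Fin n → Bool} {z : Fin n → ℝ} (h : signSum x z = 0)
    (θ : ℝ) (p : Fin n → ℝ) :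
    signSum x p ^ 2 = signSum x (fun j => θ * z j - p j) ^ 2 := by
  rw [signSum_sub, signSum_smul, h]
  ring

/-- A normal vector with a dilate close to the lattice produces an integer vector that is almost
orthogonal to the rows and is short or itself spread. -/
lemma exists_lattice_of_not_spread {s : Fin n → Fin n → Bool} (hs : OpBounded s) (i : Fin n)
    {z : Fin n → ℝ} (hz : ∑ j, z j ^ 2 = 1) (horth : ∀ k ≠ i, signSum (s k) z = 0)
    {a T r : ℝ} (hr : 16 * 5184 * a ≤ r) (hspread : ¬ Spread (1 / 5184) a T z) :
    ∃ p : Fin n → ℤ, 0 < ∑ j, (p j : ℝ) ^ 2 ∧ ∑ j, (p j : ℝ) ^ 2 ≤ 4 * T ^ 2 ∧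
      ((∑ j, (p j : ℝ) ^ 2 ≤ r ∧
        ∑ k ∈ Finset.univ.erase i, signSum (s k) (fun j => p j) ^ 2 ≤
          n * (∑ j, (p j : ℝ) ^ 2) / 16) ∨
      (r < ∑ j, (p j : ℝ) ^ 2 ∧
        ∑ k ∈ Finset.univ.erase i, signSum (s k) (fun j => p j) ^ 2 ≤ 81 * n * a ∧
        Spread ((∑ j, (p j : ℝ) ^ 2) / (16 * 5184)) (a / 4) (1 / 4) fun j => (p j : ℝ))) := by
  obtain ⟨θ₀, hpos, hT, hlt, hsp⟩ := exists_almost_first_failure (by norm_num) hz hspread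
  set p : Fin n → ℤ := fun j => round (θ₀ * z j) with hp
  set w := ∑ j, (p j : ℝ) ^ 2 with hw
  set d := latDist fun j => θ₀ * z j with hd
  have hd0 : 0 ≤ d := latDist_nonneg _
  have hd1 : d < 1 / 5184 * θ₀ ^ 2 := hlt.trans_le (min_le_left _ _)
  have hd2 : d < a := hlt.trans_le (min_le_right _ _)
  have hdz : ∑ j, (θ₀ * z j) ^ 2 = θ₀ ^ 2 := by
    simp_rw [mul_pow]
    rw [← Finset.mul_sum, hz, mul_one]
  have hd' : d = ∑ j, (θ₀ * z j - p j) ^ 2 := rfl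
  have hw1 : w ≤ 2 * θ₀ ^ 2 + 2 * d := by
    rw [← hdz, hd', hw, Finset.mul_sum, Finset.mul_sum, ← Finset.sum_add_distrib]
    exact Finset.sum_le_sum fun j _ => by nlinarith [sq_nonneg (θ₀ * z j + (θ₀ * z j - p j))]
  have hw2 : θ₀ ^ 2 ≤ 2 * w + 2 * d := by
    rw [← hdz, hd', hw, Finset.mul_sum, Finset.mul_sum, ← Finset.sum_add_distrib]
    exact Finset.sum_le_sum fun j _ => by nlinarith [sq_nonneg (p j - (θ₀ * z j - p j))]
  have hθ2 : 0 < θ₀ ^ 2 := by positivity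
  have hrow : ∑ k ∈ Finset.univ.erase i, signSum (s k) (fun j => (p j : ℝ)) ^ 2 ≤ 81 * n * d := by
    calc ∑ k ∈ Finset.univ.erase i, signSum (s k) (fun j => (p j : ℝ)) ^ 2
        = ∑ k ∈ Finset.univ.erase i, signSum (s k) (fun j => θ₀ * z j - p j) ^ 2 :=
          Finset.sum_congr rfl fun k hk =>
            signSum_sq_eq_of_orthogonal (horth k (Finset.ne_of_mem_erase hk)) θ₀ _
      _ ≤ ∑ k, signSum (s k) (fun j => θ₀ * z j - p j) ^ 2 :=
          Finset.sum_le_sum_of_subset_of_nonneg (Finset.erase_subset _ _)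
            fun _ _ _ => sq_nonneg _
      _ ≤ 81 * n * d := hs _
  have hn0 : (0 : ℝ) ≤ n := Nat.cast_nonneg n
  refine ⟨p, by linarith, ?_, ?_⟩
  · nlinarith [pow_le_pow_left₀ hpos.le hT 2]
  rcases le_or_gt w r with hwr | hwr
  · refine Or.inl ⟨hwr, hrow.trans ?_⟩
    have : 81 * d ≤ w / 16 := by linarith
    nlinarith
  · refine Or.inr ⟨hwr, hrow.trans (by nlinarith), fun θ hθ => ?_⟩
    have h1 := hsp (θ * θ₀) (by rw [abs_mul, abs_of_pos hpos]; nlinarith)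
    have h2 : latDist (fun j => θ * θ₀ * z j) ≤
        2 * latDist (fun j => θ * (p j : ℝ)) + 2 * (θ ^ 2 * d) := by
      refine (latDist_le _ fun j => round (θ * (p j : ℝ))).trans ?_
      rw [hd', latDist, Finset.mul_sum, Finset.mul_sum, Finset.mul_sum, ← Finset.sum_add_distrib]
      refine Finset.sum_le_sum fun j _ => ?_
      set m : ℝ := ((round (θ * (p j : ℝ)) : ℤ) : ℝ)
      nlinarith [sq_nonneg ((θ * p j - m) - θ * (θ₀ * z j - p j))]
    have hθ' : θ ^ 2 ≤ 1 / 16 := by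
      have := pow_le_pow_left₀ (abs_nonneg θ) hθ 2
      rw [sq_abs] at this
      linarith
    have hθ0 := sq_nonneg θ
    have h3 : θ ^ 2 * d ≤ θ ^ 2 * a := by gcongr
    have h4 : θ ^ 2 * a ≤ θ ^ 2 * (θ₀ ^ 2 / (4 * 5184)) := by
      gcongr
      linarith
    have h5 : θ ^ 2 * a ≤ a / 16 := by nlinarith
    have h6 : θ ^ 2 * w ≤ θ ^ 2 * (4 * θ₀ ^ 2) := by
      gcongr
      linarith
    rcases min_le_iff.1 h1 with h | h
    · refine (min_le_left _ _).trans ?_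
      rw [mul_pow] at h
      linarith
    · refine (min_le_right _ _).trans ?_
      linarith

lemma pr_short_le (i : Fin n) (p : Fin n → ℤ) (hp : 0 < ∑ j, (p j : ℝ) ^ 2) :
    pr (fun s : Fin n → Fin n → Bool =>
      ∑ k ∈ Finset.univ.erase i, signSum (s k) (fun j => p j) ^ 2 ≤
        n * (∑ j, (p j : ℝ) ^ 2) / 16) ≤ rexp (n / 128) * rexp (-1 / 16) ^ (n - 1) := by
  have h := pr_sum_sq_le (Finset.univ.erase i) (fun j => (p j : ℝ))
    (b := 1 / (8 * ∑ j, (p j : ℝ) ^ 2)) (R := n * (∑ j, (p j : ℝ) ^ 2) / 16)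
    (ρ := rexp (-1 / 16)) (by positivity) (by
      simpa [div_eq_mul_inv] using avg_exp_neg_signSum_sq_le_of_pos _ rfl hp)
  rw [Finset.card_erase_of_mem (Finset.mem_univ i), Finset.card_univ, Fintype.card_fin] at h
  convert h using 3
  field_simp
  ring

lemma pr_spread_le (i : Fin n) (p : Fin n → ℤ) {a : ℝ} (ha : 0 < a)
    (hp : 0 < ∑ j, (p j : ℝ) ^ 2)
    (h : Spread ((∑ j, (p j : ℝ) ^ 2) / (16 * 5184)) (a / 4) (1 / 4) fun j => (p j : ℝ)) :
    pr (fun s : Fin n → Fin n → Bool =>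
      ∑ k ∈ Finset.univ.erase i, signSum (s k) (fun j => p j) ^ 2 ≤ 81 * n * a) ≤
      rexp (n / 2) * (4080 * √a / √(∑ j, (p j : ℝ) ^ 2) + 3 * rexp (-a / 2)) ^ (n - 1) := by
  set w := ∑ j, (p j : ℝ) ^ 2 with hw
  have h1 := avg_exp_neg_signSum_sq_le (fun j => (p j : ℝ)) (τ := 9 * √a) (by positivity)
    (by positivity) (by norm_num) h
  have hsw : √(w / (16 * 5184)) = √w / 288 := by
    rw [Real.sqrt_div hp.le]
    congr 1
    rw [Real.sqrt_eq_iff_mul_self_eq] <;> norm_num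
  have hw0 : 0 < √w := Real.sqrt_pos.2 hp
  have e1 : π * (9 * √a) / (2 * √(w / (16 * 5184))) ≤ 4080 * √a / √w := by
    rw [hsw, show π * (9 * √a) / (2 * (√w / 288)) = 1296 * π * √a / √w by field_simp; norm_num]
    gcongr
    linarith [Real.pi_lt_d4]
  have e2 : rexp (-2 * (a / 4)) = rexp (-a / 2) := by ring_nf
  have e3 : rexp (-(π * (9 * √a) * (1 / 4)) ^ 2 / 4) ≤ rexp (-a / 2) := by
    refine Real.exp_le_exp.2 ?_
    have : (π * (9 * √a) * (1 / 4)) ^ 2 = π ^ 2 * (81 / 16 * a) := by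
      rw [mul_pow, mul_pow, mul_pow, Real.sq_sqrt ha.le]; ring
    rw [this]
    have h9 : 9 ≤ π ^ 2 := by nlinarith [Real.pi_gt_three]
    nlinarith
  have h2 := pr_sum_sq_le (Finset.univ.erase i) (fun j => (p j : ℝ))
    (b := 1 / (2 * (81 * a))) (R := 81 * n * a)
    (ρ := 4080 * √a / √w + 3 * rexp (-a / 2)) (by positivity) (by
      have hτ : (9 * √a) ^ 2 = 81 * a := by rw [mul_pow, Real.sq_sqrt ha.le]; norm_num
      rw [hτ] at h1
      simp_rw [mul_one_div]
      linarith)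
  rw [Finset.card_erase_of_mem (Finset.mem_univ i), Finset.card_univ, Fintype.card_fin] at h2
  convert h2 using 3
  field_simp

end Structure

section Structured

open Real

variable {n : ℕ}

lemma pr_exists_short_le (i : Fin n) {r : ℝ} (hr0 : 0 ≤ r) (hr : 5 * r + 1 / 16 ≤ n / 100) :
    pr (fun s : Fin n → Fin n → Bool => ∃ p : Fin n → ℤ, 0 < ∑ j, (p j : ℝ) ^ 2 ∧
      ∑ j, (p j : ℝ) ^ 2 ≤ r ∧
      ∑ k ∈ Finset.univ.erase i, signSum (s k) (fun j => p j) ^ 2 ≤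
        n * (∑ j, (p j : ℝ) ^ 2) / 16) ≤ rexp (-n / 50) := by
  have hn : 1 ≤ n := Nat.one_le_iff_ne_zero.2 fun h => by subst h; exact i.elim0
  set S := (latticeBall n ⌊r⌋₊).filter fun p : Fin n → ℤ => 0 < ∑ j, (p j : ℝ) ^ 2 with hS
  have hcard : (S.card : ℝ) ≤ rexp (5 * r) * rexp (2 * n / 99) := by
    have h1 : (S.card : ℝ) ≤ (latticeBall n ⌊r⌋₊).card := by
      exact_mod_cast Finset.card_filter_le _ _
    have h2 := card_latticeBall_mul_pow_le (n := n) (x := 1 / 100) (by norm_num) (by norm_num)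
      ⌊r⌋₊
    have h3 : (100 : ℝ) ^ ⌊r⌋₊ ≤ rexp (5 * r) := by
      have h100 : (100 : ℝ) ≤ rexp 5 := by
        have := pow_le_pow_left₀ (by norm_num) Real.exp_one_gt_d9.le 5
        rw [← Real.exp_nat_mul] at this
        norm_num at this ⊢
        linarith
      calc (100 : ℝ) ^ ⌊r⌋₊ ≤ rexp 5 ^ ⌊r⌋₊ := by gcongr
        _ = rexp (⌊r⌋₊ * 5) := (Real.exp_nat_mul _ _).symm
        _ ≤ rexp (5 * r) := Real.exp_le_exp.2 (by linarith [Nat.floor_le hr0])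
    have h4 : ((1 + 1 / 100 : ℝ) / (1 - 1 / 100)) ^ n ≤ rexp (2 * n / 99) := by
      calc ((1 + 1 / 100 : ℝ) / (1 - 1 / 100)) ^ n ≤ rexp (2 / 99) ^ n := by
            gcongr
            linarith [Real.add_one_le_exp (2 / 99 : ℝ)]
        _ = rexp (2 * n / 99) := by rw [← Real.exp_nat_mul]; ring_nf
    have h5 : ((latticeBall n ⌊r⌋₊).card : ℝ) =
        100 ^ ⌊r⌋₊ * ((latticeBall n ⌊r⌋₊).card * (1 / 100) ^ ⌊r⌋₊) := by
      rw [one_div, inv_pow, mul_left_comm, mul_inv_cancel₀ (by positivity), mul_one]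
    rw [h5] at h1
    exact h1.trans (mul_le_mul h3 (h2.trans h4)
      (mul_nonneg (Nat.cast_nonneg _) (pow_nonneg (by norm_num) _)) (Real.exp_nonneg _))
  refine (pr_mono (Q := fun s : Fin n → Fin n → Bool => ∃ p ∈ S,
      ∑ k ∈ Finset.univ.erase i, signSum (s k) (fun j => p j) ^ 2 ≤
        n * (∑ j, (p j : ℝ) ^ 2) / 16) ?_).trans ?_
  · rintro s ⟨p, hp0, hpr, hp⟩
    refine ⟨p, Finset.mem_filter.2 ⟨mem_latticeBall.2 (Nat.le_floor ?_), hp0⟩, hp⟩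
    exact (sum_natAbs_le_sum_sq p).trans hpr
  · refine (pr_exists_le _ _).trans ((Finset.sum_le_card_nsmul _ _ _ fun p hp =>
      pr_short_le i p (Finset.mem_filter.1 hp).2).trans ?_)
    rw [nsmul_eq_mul]
    refine (mul_le_mul_of_nonneg_right hcard (by positivity)).trans ?_
    rw [← Real.exp_nat_mul, ← Real.exp_add, ← Real.exp_add, ← Real.exp_add, Nat.cast_sub hn]
    refine Real.exp_le_exp.2 ?_
    push_cast
    linarith

lemma pr_exists_spread_le (i : Fin n) {a r T : ℝ} (ha : 0 < a) (hr : 0 < r)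
    (haT : 3 * rexp (-a / 2) ≤ 20 * √a / (2 * T)) (hT : 0 < T)
    (hsmall : 4100 * √a * (1 / √r + 2 / √n) ≤ rexp (-3)) :
    pr (fun s : Fin n → Fin n → Bool => ∃ p : Fin n → ℤ, r < ∑ j, (p j : ℝ) ^ 2 ∧
      ∑ j, (p j : ℝ) ^ 2 ≤ 4 * T ^ 2 ∧
      ∑ k ∈ Finset.univ.erase i, signSum (s k) (fun j => p j) ^ 2 ≤ 81 * n * a ∧
        Spread ((∑ j, (p j : ℝ) ^ 2) / (16 * 5184)) (a / 4) (1 / 4) fun j => (p j : ℝ)) ≤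
      (4 * T ^ 2 + 1) * (8 * T ^ 2 + 1) * rexp (3 - 3 * n / 2) := by
  classical
  have hn : 1 ≤ n := Nat.one_le_iff_ne_zero.2 fun h => by subst h; exact i.elim0
  have hn' : (1 : ℝ) ≤ n := by exact_mod_cast hn
  set N := ⌊4 * T ^ 2⌋₊ with hN
  have hNT : (N : ℝ) ≤ 4 * T ^ 2 := Nat.floor_le (by positivity)
  set S : ℕ → Finset (Fin n → ℤ) := fun L => (latticeBall n L).filter fun p =>
    (∑ j, (p j).natAbs = L ∧ r < ∑ j, (p j : ℝ) ^ 2 ∧ ∑ j, (p j : ℝ) ^ 2 ≤ 4 * T ^ 2) ∧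
      Spread ((∑ j, (p j : ℝ) ^ 2) / (16 * 5184)) (a / 4) (1 / 4) fun j => (p j : ℝ) with hS
  have hlevel : ∀ L ∈ Finset.range (N + 1), pr (fun s : Fin n → Fin n → Bool => ∃ p ∈ S L,
      ∑ k ∈ Finset.univ.erase i, signSum (s k) (fun j => p j) ^ 2 ≤ 81 * n * a) ≤
        (8 * T ^ 2 + 1) * rexp (3 - 3 * n / 2) := by
    intro L hL
    have hLN : (L : ℝ) ≤ 4 * T ^ 2 :=
      le_trans (by exact_mod_cast Finset.mem_range_succ_iff.1 hL) hNT
    set q : ℝ := 1 + 2 * L / n with hq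
    have hq0 : 0 < q := by positivity
    have hqT : q ≤ 8 * T ^ 2 + 1 := by
      have : 2 * (L : ℝ) / n ≤ 2 * L := div_le_self (by positivity) hn'
      linarith
    have hp : ∀ p ∈ S L, pr (fun s : Fin n → Fin n → Bool =>
        ∑ k ∈ Finset.univ.erase i, signSum (s k) (fun j => p j) ^ 2 ≤ 81 * n * a) ≤
          rexp (n / 2) * (rexp (-3) / q) ^ (n - 1) := by
      intro p hp
      obtain ⟨-, ⟨hpL, hpr, hpT⟩, hsp⟩ := Finset.mem_filter.1 hp
      refine (pr_spread_le i p ha (hr.trans hpr) hsp).trans ?_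
      set w := ∑ j, (p j : ℝ) ^ 2 with hw
      have hw0 : 0 < √w := Real.sqrt_pos.2 (hr.trans hpr)
      have hwT : √w ≤ 2 * T := Real.sqrt_le_iff.2 ⟨by positivity, by linarith⟩
      have h1 : 3 * rexp (-a / 2) ≤ 20 * √a / √w := haT.trans (by gcongr)
      have hLw : (L : ℝ) ≤ √n * √w := by
        rw [← Real.sqrt_mul (Nat.cast_nonneg n)]
        refine Real.le_sqrt_of_sq_le ?_
        rw [← hpL]
        exact sq_sum_natAbs_le p
      have h2 : q / √w ≤ 1 / √r + 2 / √n := by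
        rw [hq, add_div]
        have hrw : √r ≤ √w := Real.sqrt_le_sqrt hpr.le
        have hr0 : 0 < √r := Real.sqrt_pos.2 hr
        have hn0 : 0 < √(n : ℝ) := Real.sqrt_pos.2 (by linarith)
        refine add_le_add (by gcongr) ?_
        rw [div_div, div_le_div_iff₀ (by positivity) hn0]
        calc 2 * (L : ℝ) * √n ≤ 2 * (√n * √w) * √n := by gcongr
          _ = 2 * (√n * √n * √w) := by ring
          _ = 2 * (n * √w) := by rw [Real.mul_self_sqrt (Nat.cast_nonneg n)]
      have h3 : 4080 * √a / √w + 3 * rexp (-a / 2) ≤ rexp (-3) / q := by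
        rw [le_div_iff₀ hq0]
        calc (4080 * √a / √w + 3 * rexp (-a / 2)) * q
            ≤ (4080 * √a / √w + 20 * √a / √w) * q := by gcongr
          _ = 4100 * √a * (q / √w) := by ring
          _ ≤ 4100 * √a * (1 / √r + 2 / √n) := by gcongr
          _ ≤ rexp (-3) := hsmall
      gcongr
    have hcard : ((S L).card : ℝ) ≤ (rexp 1 * q) ^ n :=
      le_trans (by exact_mod_cast Finset.card_filter_le _ _) (card_latticeBall_le hn L)
    refine (pr_exists_le _ _).trans ((Finset.sum_le_card_nsmul _ _ _ hp).trans ?_)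
    rw [nsmul_eq_mul]
    calc ((S L).card : ℝ) * (rexp (n / 2) * (rexp (-3) / q) ^ (n - 1))
        ≤ (rexp 1 * q) ^ n * (rexp (n / 2) * (rexp (-3) / q) ^ (n - 1)) := by gcongr
      _ = q * rexp (3 - 3 * n / 2) := by
          have : rexp (3 - 3 * n / 2) =
              rexp (n * 1) * rexp (n / 2) * rexp ((n - 1 : ℕ) * -3) := by
            rw [← Real.exp_add, ← Real.exp_add, Nat.cast_sub hn]
            push_cast
            ring_nf
          rw [this, mul_pow, div_pow, ← pow_sub_one_mul (Nat.one_le_iff_ne_zero.1 hn) q,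
            ← Real.exp_nat_mul, ← Real.exp_nat_mul]
          field_simp
      _ ≤ (8 * T ^ 2 + 1) * rexp (3 - 3 * n / 2) := by gcongr
  refine (pr_mono (Q := fun s : Fin n → Fin n → Bool => ∃ L ∈ Finset.range (N + 1), ∃ p ∈ S L,
      ∑ k ∈ Finset.univ.erase i, signSum (s k) (fun j => p j) ^ 2 ≤ 81 * n * a) ?_).trans ?_
  · rintro s ⟨p, hpr, hpT, hp, hsp⟩
    refine ⟨∑ j, (p j).natAbs, Finset.mem_range_succ_iff.2 (Nat.le_floor ?_), p,
      Finset.mem_filter.2 ⟨mem_latticeBall.2 le_rfl, ⟨rfl, hpr, hpT⟩, hsp⟩, hp⟩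
    exact (sum_natAbs_le_sum_sq p).trans hpT
  · refine (pr_exists_le _ _).trans ((Finset.sum_le_card_nsmul _ _ _ hlevel).trans ?_)
    rw [nsmul_eq_mul, Finset.card_range, mul_assoc]
    gcongr
    push_cast
    linarith

lemma pr_not_spread_le (i : Fin n) {a r T : ℝ} (ha : 0 < a) (hr : 5 * r + 1 / 16 ≤ n / 100)
    (har : 16 * 5184 * a ≤ r) (hT : 0 < T) (haT : 3 * rexp (-a / 2) ≤ 20 * √a / (2 * T))
    (hsmall : 4100 * √a * (1 / √r + 2 / √n) ≤ rexp (-3)) :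
    pr (fun s : Fin n → Fin n → Bool => OpBounded s ∧ ∃ z : Fin n → ℝ, ∑ j, z j ^ 2 = 1 ∧
      (∀ k ≠ i, signSum (s k) z = 0) ∧ ¬ Spread (1 / 5184) a T z) ≤
      rexp (-n / 50) + (4 * T ^ 2 + 1) * (8 * T ^ 2 + 1) * rexp (3 - 3 * n / 2) := by
  have hr0 : 0 < r := by linarith
  refine le_trans ?_ (add_le_add (pr_exists_short_le i hr0.le hr)
    (pr_exists_spread_le i ha hr0 haT hT hsmall))
  refine (pr_mono ?_).trans (pr_or_le _ _)
  rintro s ⟨hs, z, hz, horth, hsp⟩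
  obtain ⟨p, hp0, hpT, ⟨hpr, hp⟩ | ⟨hpr, hp, hp'⟩⟩ :=
    exists_lattice_of_not_spread hs i hz horth har hsp
  · exact Or.inl ⟨p, hp0, hpr, hp⟩
  · exact Or.inr ⟨p, hpr, hpT, hp, hp'⟩

lemma pr_abs_signSum_le {z : Fin n → ℝ} {a T δ : ℝ} (hδ : 0 < δ) (hT : 0 ≤ T)
    (h : Spread (1 / 5184) a T z) :
    pr (fun x => |signSum x z| ≤ δ) ≤
      rexp 1 * (36 * π * δ + rexp (-2 * a) + 2 * rexp (-(π * δ * T) ^ 2 / 4)) := by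
  have h1 := avg_exp_neg_signSum_sq_le z (by norm_num) hδ hT h
  have h72 : √(1 / 5184 : ℝ) = 1 / 72 := by
    rw [Real.sqrt_eq_iff_mul_self_eq] <;> norm_num
  rw [h72, show π * δ / (2 * (1 / 72)) = 36 * π * δ by ring] at h1
  refine le_trans (pr_le_avg (f := fun x => rexp 1 * rexp (-signSum x z ^ 2 / (2 * δ ^ 2)))
    (fun x => by positivity) fun x hx => ?_) ?_
  · rw [← Real.exp_add]
    refine Real.one_le_exp ?_
    have h2 : signSum x z ^ 2 ≤ δ ^ 2 := sq_le_sq' (neg_le_of_abs_le hx) (le_of_abs_le hx)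
    have h3 : signSum x z ^ 2 / (2 * δ ^ 2) ≤ 1 := by
      rw [div_le_one (by positivity)]
      nlinarith
    rw [neg_div]
    linarith
  · rw [avg_mul_left]
    gcongr

lemma pr_spread_normal_le (i : Fin n) (z : ({k // k ≠ i} → Fin n → Bool) → Fin n → ℝ)
    {a T δ : ℝ} (hδ : 0 < δ) (hT : 0 ≤ T) :
    pr (fun s : Fin n → Fin n → Bool => Spread (1 / 5184) a T (z fun k => s k) ∧
      |signSum (s i) (z fun k => s k)| ≤ δ) ≤
      rexp 1 * (36 * π * δ + rexp (-2 * a) + 2 * rexp (-(π * δ * T) ^ 2 / 4)) := by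
  set R := rexp 1 * (36 * π * δ + rexp (-2 * a) + 2 * rexp (-(π * δ * T) ^ 2 / 4)) with hR
  have hR0 : 0 ≤ R := by positivity
  classical
  let f : (Fin n → Bool) × ({k // k ≠ i} → Fin n → Bool) → ℝ := fun q =>
    if Spread (1 / 5184) a T (z q.2) ∧ |signSum q.1 (z q.2)| ≤ δ then 1 else 0
  have h1 : pr (fun s : Fin n → Fin n → Bool => Spread (1 / 5184) a T (z fun k => s k) ∧
      |signSum (s i) (z fun k => s k)| ≤ δ) = avg f := by
    rw [← avg_comp_equiv (Equiv.funSplitAt i (Fin n → Bool)) f]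
    unfold pr
    congr 1
    ext s
    by_cases h : Spread (1 / 5184) a T (z fun k => s k) ∧ |signSum (s i) (z fun k => s k)| ≤ δ
    · exact (if_pos h).trans (if_pos h).symm
    · exact (if_neg h).trans (if_neg h).symm
  rw [h1, avg_prod]
  refine (avg_mono fun t => ?_).trans (avg_const R).le
  by_cases ht : Spread (1 / 5184) a T (z t)
  · refine le_trans (le_of_eq ?_) (pr_abs_signSum_le hδ hT ht)
    unfold pr
    congr 1
    ext x
    exact if_congr (and_iff_right ht) rfl rfl
  · have : ∀ x, f (x, t) = 0 := fun x => if_neg fun h => ht h.1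
    simp_rw [this]
    rwa [avg_const]

end Structured

section Reduction

open Real

variable {n : ℕ}

lemma exists_smul_sum_sq_eq_one {z : Fin n → ℝ} (hz : z ≠ 0) :
    ∃ c : ℝ, ∑ j, (c * z j) ^ 2 = 1 := by
  have hpos : 0 < ∑ j, z j ^ 2 := by
    obtain ⟨j, hj⟩ := Function.ne_iff.1 hz
    exact Finset.sum_pos' (fun _ _ => sq_nonneg _) ⟨j, Finset.mem_univ j, sq_pos_of_ne_zero hj⟩
  refine ⟨(√(∑ j, z j ^ 2))⁻¹, ?_⟩
  simp_rw [mul_pow]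
  rw [← Finset.mul_sum, inv_pow, Real.sq_sqrt hpos.le, inv_mul_cancel₀ hpos.ne']

lemma exists_unit_normal (i : Fin n) (t : {k // k ≠ i} → Fin n → Bool) :
    ∃ z : Fin n → ℝ, ∑ j, z j ^ 2 = 1 ∧ ∀ k, signSum (t k) z = 0 := by
  have hn : 0 < n := i.pos
  set f : (Fin n → ℝ) →ₗ[ℝ] ({k // k ≠ i} → ℝ) :=
    Matrix.mulVecLin (Matrix.of fun k j => sgn (t k j)) with hf
  have hker : LinearMap.ker f ≠ ⊥ := LinearMap.ker_ne_bot_of_finrank_lt (by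
    simp only [ne_eq, Module.finrank_fintype_fun_eq_card, Fintype.card_fin,
      Fintype.card_subtype_compl, Fintype.card_unique]
    omega)
  obtain ⟨z, hz, hz0⟩ := Submodule.exists_mem_ne_zero_of_ne_bot hker
  obtain ⟨c, hc⟩ := exists_smul_sum_sq_eq_one hz0
  refine ⟨fun j => c * z j, hc, fun k => ?_⟩
  rw [signSum_smul]
  have : signSum (t k) z = f z k := rfl
  rw [this, LinearMap.mem_ker.1 hz, Pi.zero_apply, mul_zero]

lemma toEuclideanLin_norm_sq (M : Matrix (Fin n) (Fin n) ℝ) (v : EuclideanSpace ℝ (Fin n)) :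
    ‖Matrix.toEuclideanLin M v‖ ^ 2 = ∑ j, (M.mulVec v) j ^ 2 := by
  rw [EuclideanSpace.real_norm_sq_eq]
  rfl

lemma specNorm_le {M : Matrix (Fin n) (Fin n) ℝ} (hM : ∀ i j, M i j ^ 2 ≤ 1) :
    specNorm M ≤ n := by
  refine ContinuousLinearMap.opNorm_le_bound _ (Nat.cast_nonneg n) fun v => ?_
  rw [LinearMap.coe_toContinuousLinearMap']
  refine (sq_le_sq₀ (norm_nonneg _) (by positivity)).1 ?_
  rw [toEuclideanLin_norm_sq, mul_pow, EuclideanSpace.real_norm_sq_eq]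
  calc ∑ i, (M.mulVec v) i ^ 2 ≤ ∑ _i : Fin n, n * ∑ j, v j ^ 2 := by
        refine Finset.sum_le_sum fun i _ => ?_
        refine (Finset.sum_mul_sq_le_sq_mul_sq Finset.univ (M i) v).trans ?_
        gcongr
        refine (Finset.sum_le_card_nsmul _ _ _ fun j _ => hM i j).trans ?_
        simp
    _ = n ^ 2 * ∑ j, v j ^ 2 := by
        rw [Finset.sum_const, Finset.card_univ, Fintype.card_fin, nsmul_eq_mul]
        ring

/-- A singular or badly conditioned matrix maps some unit vector to a short one. -/
lemma exists_unit_mulVec_le {M : Matrix (Fin n) (Fin n) ℝ} {κ : ℝ} (hκ : 0 < κ)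
    (h : M.det = 0 ∨ κ ≤ specNorm M⁻¹) :
    ∃ y : Fin n → ℝ, ∑ j, y j ^ 2 = 1 ∧ ∑ j, (M.mulVec y) j ^ 2 ≤ (2 / κ) ^ 2 := by
  by_cases hdet : M.det = 0
  · obtain ⟨y, hy0, hy⟩ := Matrix.exists_mulVec_eq_zero_iff.2 hdet
    obtain ⟨c, hc⟩ := exists_smul_sum_sq_eq_one hy0
    refine ⟨c • y, by simpa using hc, ?_⟩
    rw [Matrix.mulVec_smul, hy]
    simp only [smul_zero, Pi.zero_apply, ne_eq, two_ne_zero, not_false_eq_true, zero_pow,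
      Finset.sum_const_zero]
    positivity
  · have hκ' := h.resolve_left hdet
    obtain ⟨v, hv, hlt⟩ := ContinuousLinearMap.exists_lt_apply_of_lt_opNorm _
      (show κ / 2 < specNorm M⁻¹ by linarith)
    rw [LinearMap.coe_toContinuousLinearMap'] at hlt
    set u : Fin n → ℝ := M⁻¹.mulVec v with hu
    have hMu : M.mulVec u = v := by
      rw [hu, Matrix.mulVec_mulVec, Matrix.mul_nonsing_inv _ (isUnit_iff_ne_zero.2 hdet),
        Matrix.one_mulVec]
    have hu2 : (κ / 2) ^ 2 < ∑ j, u j ^ 2 := by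
      rw [hu, ← toEuclideanLin_norm_sq]
      gcongr
    have hu0 : 0 < ∑ j, u j ^ 2 := lt_trans (by positivity) hu2
    set c := (√(∑ j, u j ^ 2))⁻¹ with hc
    have hc2 : c ^ 2 = (∑ j, u j ^ 2)⁻¹ := by rw [hc, inv_pow, Real.sq_sqrt hu0.le]
    refine ⟨c • u, ?_, ?_⟩
    · simp only [Pi.smul_apply, smul_eq_mul, mul_pow]
      rw [← Finset.mul_sum, hc2, inv_mul_cancel₀ hu0.ne']
    · rw [Matrix.mulVec_smul, hMu]
      simp only [Pi.smul_apply, smul_eq_mul, mul_pow]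
      rw [← Finset.mul_sum, hc2, ← EuclideanSpace.real_norm_sq_eq]
      have hv2 : ‖v‖ ^ 2 ≤ 1 := pow_le_one₀ (norm_nonneg _) hv.le
      calc (∑ j, u j ^ 2)⁻¹ * ‖v‖ ^ 2 ≤ ((κ / 2) ^ 2)⁻¹ * 1 := by gcongr
        _ = (2 / κ) ^ 2 := by rw [mul_one, ← inv_pow, inv_div]

/-- Some vector of the family is almost orthogonal to every unit normal of the others. -/
def HasNearDependence (δ : ℝ) (s : Fin n → Fin n → Bool) : Prop :=
  ∃ i, ∀ z : Fin n → ℝ, ∑ j, z j ^ 2 = 1 → (∀ k ≠ i, signSum (s k) z = 0) →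
    |signSum (s i) z| ≤ δ

lemma hasNearDependence_of_mulVec_le (hn : 0 < n) {s : Fin n → Fin n → Bool} {y : Fin n → ℝ}
    {ε : ℝ} (hε : 0 ≤ ε) (hy : ∑ j, y j ^ 2 = 1)
    (h : ∑ j, ((Matrix.of fun i j => sgn (s i j)).mulVec y) j ^ 2 ≤ ε ^ 2) :
    HasNearDependence (√n * ε) fun k j => s j k := by
  have hn' : (0 : ℝ) < n := by exact_mod_cast hn
  obtain ⟨i, hi⟩ : ∃ i, 1 / (n : ℝ) ≤ y i ^ 2 := by
    by_contra! hcon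
    have : Nonempty (Fin n) := ⟨⟨0, hn⟩⟩
    have h1 := Finset.sum_lt_sum_of_nonempty (s := (Finset.univ : Finset (Fin n)))
      Finset.univ_nonempty fun i _ => hcon i
    rw [hy, Finset.sum_const, Finset.card_univ, Fintype.card_fin, nsmul_eq_mul,
      mul_one_div_cancel hn'.ne'] at h1
    exact lt_irrefl _ h1
  refine ⟨i, fun z hz horth => ?_⟩
  have h1 : ∑ j, z j * ((Matrix.of fun i j => sgn (s i j)).mulVec y) j =
      y i * signSum (fun j => s j i) z := by
    rw [← Finset.sum_eq_single (f := fun k => y k * signSum (fun j => s j k) z) i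
      (fun k _ hk => by rw [horth k hk, mul_zero]) (fun hi => absurd (Finset.mem_univ i) hi)]
    simp only [Matrix.mulVec, dotProduct, Matrix.of_apply, signSum, Finset.mul_sum]
    rw [Finset.sum_comm]
    exact Finset.sum_congr rfl fun _ _ => Finset.sum_congr rfl fun _ _ => by ring
  have h2 := Finset.sum_mul_sq_le_sq_mul_sq Finset.univ z
    fun j => ((Matrix.of fun i j => sgn (s i j)).mulVec y) j
  rw [h1, hz, one_mul, mul_pow] at h2
  refine abs_le_of_sq_le_sq ?_ (by positivity)
  rw [mul_pow, Real.sq_sqrt hn'.le]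
  set S := signSum (fun j => s j i) z ^ 2
  have hS : 0 ≤ S := sq_nonneg _
  have h3 : 1 / (n : ℝ) * S ≤ ε ^ 2 := (mul_le_mul_of_nonneg_right hi hS).trans (h2.trans h)
  rw [one_div, inv_mul_le_iff₀ hn'] at h3
  exact h3

lemma pr_hasNearDependence_le (hn : 0 < n) {δ T η σ : ℝ} (hσ : ∀ i : Fin n,
      pr (fun s : Fin n → Fin n → Bool => OpBounded s ∧ ∃ z : Fin n → ℝ, ∑ j, z j ^ 2 = 1 ∧
        (∀ k ≠ i, signSum (s k) z = 0) ∧ ¬ Spread (1 / 5184) η T z) ≤ σ)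
    (hδ : 0 < δ) (hT : 0 ≤ T) :
    pr (fun s : Fin n → Fin n → Bool => HasNearDependence δ s) ≤ (1 / 2) ^ n + n * (σ +
      rexp 1 * (36 * π * δ + rexp (-2 * η) + 2 * rexp (-(π * δ * T) ^ 2 / 4))) := by
  choose z hz horth using fun i : Fin n => exists_unit_normal i
  refine (pr_mono (Q := fun s : Fin n → Fin n → Bool => ¬ OpBounded s ∨ ∃ i ∈ Finset.univ,
    (OpBounded s ∧ ∃ z : Fin n → ℝ, ∑ j, z j ^ 2 = 1 ∧
        (∀ k ≠ i, signSum (s k) z = 0) ∧ ¬ Spread (1 / 5184) η T z) ∨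
    (Spread (1 / 5184) η T (z i fun k => s k) ∧ |signSum (s i) (z i fun k => s k)| ≤ δ))
    ?_).trans ?_
  · rintro s ⟨i, hi⟩
    by_cases hs : OpBounded s
    · have horth' : ∀ k ≠ i, signSum (s k) (z i fun k => s k) = 0 := fun k hk =>
        horth i (fun k => s k) ⟨k, hk⟩
      refine Or.inr ⟨i, Finset.mem_univ i, ?_⟩
      by_cases hsp : Spread (1 / 5184) η T (z i fun k => s k)
      · exact Or.inr ⟨hsp, hi _ (hz i _) horth'⟩
      · exact Or.inl ⟨hs, _, hz i _, horth', hsp⟩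
    · exact Or.inl hs
  · refine (pr_or_le _ _).trans (add_le_add (pr_not_opBounded_le hn)
      ((pr_exists_le _ _).trans ((Finset.sum_le_card_nsmul _ _ _ fun i _ =>
        (pr_or_le _ _).trans (add_le_add (hσ i) (pr_spread_normal_le i (z i) hδ hT))).trans ?_)))
    rw [Finset.card_univ, Fintype.card_fin, nsmul_eq_mul]

end Reduction

section Asymptotics

open Real Filter Topology

variable {n : ℕ}

lemma pr_hasNearDependence_le_one_div_pow (k : ℕ) {u : ℝ} (hu : 10000 ≤ u) (hun : u ^ 16 = n)
    (hexp : (n : ℝ) ^ (5 * k + 13) * rexp (-u) ≤ 1 / 10000) :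
    pr (fun s : Fin n → Fin n → Bool => HasNearDependence (1 / (n : ℝ) ^ (k + 2)) s) ≤
      1 / (n : ℝ) ^ k := by
  set X : ℝ := (n : ℝ) with hX
  set E := rexp (-u) with hE
  set T := X ^ (k + 3) with hT
  have hu1 : 1 ≤ u := by linarith
  have huX : 10000 * u ≤ X := by
    rw [← hun]
    calc 10000 * u ≤ u * u := by gcongr
      _ = u ^ 2 := by ring
      _ ≤ u ^ 16 := pow_le_pow_right₀ hu1 (by norm_num)
  have hX1 : 1 ≤ X := by linarith
  have hX0 : 0 < X := by linarith
  have hn : 0 < n := by exact_mod_cast hX ▸ hX0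
  have hT1 : 1 ≤ T := one_le_pow₀ hX1
  have hE0 : 0 < E := Real.exp_pos _
  have hTE : X ^ k * (X * T ^ 4 * E) ≤ 1 / 10000 := by
    refine le_trans (le_of_eq ?_) hexp
    rw [hT]
    ring
  have hXE : X ^ k * (X * E) ≤ 1 / 10000 := by
    refine le_trans ?_ hTE
    have : X * E ≤ X * T ^ 4 * E := by
      gcongr
      exact le_mul_of_one_le_right hX0.le (one_le_pow₀ hT1)
    gcongr
  have he3 : rexp 1 ≤ 3 := by linarith [Real.exp_one_lt_d9]
  have hTE1 : T * E ≤ 1 / 10000 := by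
    refine le_trans ?_ hTE
    have h1 : T ≤ X * T ^ 4 := by
      calc T = T ^ 1 := (pow_one T).symm
        _ ≤ T ^ 4 := pow_le_pow_right₀ hT1 (by norm_num)
        _ ≤ X * T ^ 4 := le_mul_of_one_le_left (by positivity) hX1
    have h2 : T * E ≤ X * T ^ 4 * E := by gcongr
    exact h2.trans (le_mul_of_one_le_left (by positivity) (one_le_pow₀ hX1))
  have hsu : √(u ^ 2) = u := Real.sqrt_sq (by linarith)
  have hsr : √(u ^ 8) = u ^ 4 := by
    rw [show u ^ 8 = (u ^ 4) ^ 2 by ring, Real.sqrt_sq (by positivity)]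
  have hsX : √X = u ^ 8 := by
    rw [← hun, show u ^ 16 = (u ^ 8) ^ 2 by ring, Real.sqrt_sq (by positivity)]
  have hu8 : 10000 ≤ u ^ 8 := hu.trans (le_self_pow₀ hu1 (by norm_num))
  have hσ := fun i : Fin n => pr_not_spread_le i (a := u ^ 2) (r := u ^ 8) (T := T) (by positivity)
    (by
      rw [← hX, ← hun, show u ^ 16 = u ^ 8 * u ^ 8 by ring]
      nlinarith)
    (by
      have : (10000 : ℝ) ^ 6 ≤ u ^ 6 := by gcongr
      rw [show u ^ 8 = u ^ 6 * u ^ 2 by ring]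
      gcongr
      linarith)
    (by positivity)
    (by
      have h1 : rexp (-u ^ 2 / 2) ≤ E := Real.exp_le_exp.2 (by nlinarith)
      rw [hsu, le_div_iff₀ (by positivity)]
      calc 3 * rexp (-u ^ 2 / 2) * (2 * T) ≤ 3 * E * (2 * T) := by gcongr
        _ = 6 * (T * E) := by ring
        _ ≤ 20 * u := by linarith)
    (by
      rw [← hX, hsu, hsr, hsX]
      have h1 : (1 : ℝ) / 27 ≤ rexp (-3) := by
        rw [Real.exp_neg, one_div]
        have : rexp 3 = rexp 1 ^ 3 := by rw [← Real.exp_nat_mul]; norm_num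
        have h27 : rexp 1 ^ 3 ≤ 3 ^ 3 := by gcongr
        rw [this]
        exact inv_anti₀ (by positivity) (by linarith)
      refine le_trans ?_ h1
      have h2 : 2 / u ^ 8 ≤ 2 / u ^ 4 := by
        gcongr
        norm_num
      have h3 : (10000 : ℝ) ^ 3 ≤ u ^ 3 := by gcongr
      calc 4100 * u * (1 / u ^ 4 + 2 / u ^ 8) ≤ 4100 * u * (1 / u ^ 4 + 2 / u ^ 4) := by gcongr
        _ = 12300 / u ^ 3 := by field_simp; norm_num
        _ ≤ 12300 / 10000 ^ 3 := by gcongr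
        _ ≤ 1 / 27 := by norm_num)
  refine (pr_hasNearDependence_le hn hσ (δ := 1 / X ^ (k + 2)) (by positivity)
    (by positivity)).trans ?_
  rw [← hX]
  have e1 : rexp (-X / 50) ≤ E := Real.exp_le_exp.2 (by linarith)
  have e2 : (1 / 2 : ℝ) ^ n ≤ X * E := by
    have h1 : (1 / 2 : ℝ) ≤ rexp (-1 / 50) := by linarith [Real.add_one_le_exp (-1 / 50 : ℝ)]
    calc (1 / 2 : ℝ) ^ n ≤ rexp (-1 / 50) ^ n := by gcongr
      _ = rexp (-X / 50) := by rw [← Real.exp_nat_mul, hX]; ring_nf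
      _ ≤ E := e1
      _ ≤ X * E := le_mul_of_one_le_left hE0.le hX1
  have e3 : (4 * T ^ 2 + 1) * (8 * T ^ 2 + 1) * rexp (3 - 3 * X / 2) ≤ 1215 * (T ^ 4 * E) := by
    have h1 : rexp (3 - 3 * X / 2) ≤ 27 * E := by
      have : rexp (3 - 3 * X / 2) = rexp 1 ^ 3 * rexp (-3 * X / 2) := by
        rw [← Real.exp_nat_mul, ← Real.exp_add]
        push_cast
        ring_nf
      rw [this]
      have h27 : rexp 1 ^ 3 ≤ 3 ^ 3 := by gcongr
      have : rexp (-3 * X / 2) ≤ E := Real.exp_le_exp.2 (by linarith)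
      gcongr
      linarith
    have hT2 : 1 ≤ T ^ 2 := one_le_pow₀ hT1
    calc (4 * T ^ 2 + 1) * (8 * T ^ 2 + 1) * rexp (3 - 3 * X / 2)
        ≤ (5 * T ^ 2) * (9 * T ^ 2) * (27 * E) := by
          gcongr <;> linarith
      _ = 1215 * (T ^ 4 * E) := by ring
  have e4 : rexp (-2 * u ^ 2) ≤ E := Real.exp_le_exp.2 (by nlinarith)
  have e5 : rexp (-(π * (1 / X ^ (k + 2)) * T) ^ 2 / 4) ≤ E := by
    have h1 : π * (1 / X ^ (k + 2)) * T = π * X := by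
      rw [hT]
      field_simp
      ring
    rw [h1]
    refine Real.exp_le_exp.2 ?_
    have h9 : 9 ≤ π ^ 2 := by nlinarith [Real.pi_gt_three]
    have hXX : X ≤ X ^ 2 := le_self_pow₀ hX1 two_ne_zero
    rw [mul_pow]
    nlinarith
  have e6 : rexp 1 * (36 * π * (1 / X ^ (k + 2)) + rexp (-2 * u ^ 2) +
      2 * rexp (-(π * (1 / X ^ (k + 2)) * T) ^ 2 / 4)) ≤
      3 * (144 * (1 / X ^ (k + 2)) + E + 2 * E) := by
    have : 36 * π ≤ 144 := by linarith [Real.pi_lt_four]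
    gcongr
  rw [le_div_iff₀ (by positivity)]
  calc ((1 / 2) ^ n + X * (rexp (-X / 50) +
        (4 * T ^ 2 + 1) * (8 * T ^ 2 + 1) * rexp (3 - 3 * X / 2) +
        rexp 1 * (36 * π * (1 / X ^ (k + 2)) + rexp (-2 * u ^ 2) +
          2 * rexp (-(π * (1 / X ^ (k + 2)) * T) ^ 2 / 4)))) * X ^ k
      ≤ (X * E + X * (E + 1215 * (T ^ 4 * E) +
          3 * (144 * (1 / X ^ (k + 2)) + E + 2 * E))) * X ^ k := by
        gcongr
    _ = 11 * (X ^ k * (X * E)) + 1215 * (X ^ k * (X * T ^ 4 * E)) + 432 / X := by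
        field_simp
        ring
    _ ≤ 11 * (1 / 10000) + 1215 * (1 / 10000) + 432 / 10000 := by
        gcongr
        linarith
    _ ≤ 1 := by norm_num

lemma eventually_pr_hasNearDependence_le (k : ℕ) :
    ∀ᶠ n : ℕ in atTop, pr (fun s : Fin n → Fin n → Bool =>
      HasNearDependence (1 / (n : ℝ) ^ (k + 2)) s) ≤ 1 / (n : ℝ) ^ k := by
  have hu : Tendsto (fun n : ℕ => (n : ℝ) ^ (1 / 16 : ℝ)) atTop atTop :=
    (tendsto_rpow_atTop (by norm_num)).comp tendsto_natCast_atTop_atTop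
  have h1 : ∀ᶠ u : ℝ in atTop, u ^ (16 * (5 * k + 13)) * rexp (-u) ≤ 1 / 10000 :=
    (Real.tendsto_pow_mul_exp_neg_atTop_nhds_zero _).eventually_le_const (by norm_num)
  filter_upwards [hu.eventually h1, hu.eventually_ge_atTop 10000] with n hn hn'
  have hun : ((n : ℝ) ^ (1 / 16 : ℝ)) ^ 16 = n := by
    rw [← Real.rpow_natCast, ← Real.rpow_mul (Nat.cast_nonneg n)]
    norm_num
  refine pr_hasNearDependence_le_one_div_pow k hn' hun ?_
  rwa [pow_mul, hun] at hn

lemma hasNearDependence_of_det_eq_zero_or_le (k : ℕ) (hn : 2 ≤ n) {s : Fin n → Fin n → Bool}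
    {M : Matrix (Fin n) (Fin n) ℝ} (hsM : M = Matrix.of fun i j => sgn (s i j))
    (h : M.det = 0 ∨ (n : ℝ) ^ (k + 5) ≤ specNorm M * specNorm M⁻¹) :
    HasNearDependence (1 / (n : ℝ) ^ (k + 2)) fun k j => s j k := by
  have hn2 : (2 : ℝ) ≤ n := by exact_mod_cast hn
  have hn0 : (0 : ℝ) < n := by linarith
  have hM : specNorm M ≤ n := specNorm_le fun i j => by
    rw [hsM, Matrix.of_apply, sgn]
    split_ifs <;> norm_num
  obtain ⟨y, hy, hMy⟩ := exists_unit_mulVec_le (M := M) (κ := (n : ℝ) ^ (k + 4)) (by positivity)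
    (h.imp_right fun h => by
      have h1 : (n : ℝ) ^ (k + 5) ≤ n * specNorm M⁻¹ :=
        h.trans (mul_le_mul_of_nonneg_right hM (norm_nonneg _))
      rw [pow_succ'] at h1
      exact le_of_mul_le_mul_left h1 hn0)
  rw [hsM] at hMy
  obtain ⟨i, hi⟩ := hasNearDependence_of_mulVec_le (by omega) (by positivity) hy hMy
  refine ⟨i, fun z hz horth => (hi z hz horth).trans ?_⟩
  have hsqrt : √(n : ℝ) ≤ n := Real.sqrt_le_iff.2 ⟨hn0.le, by nlinarith⟩
  calc √(n : ℝ) * (2 / (n : ℝ) ^ (k + 4)) ≤ n * (n / (n : ℝ) ^ (k + 4)) := by gcongr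
    _ = 1 / (n : ℝ) ^ (k + 2) := by
      field_simp
      ring

lemma pr_hasNearDependence_swap (δ : ℝ) :
    pr (fun s : Fin n → Fin n → Bool => HasNearDependence δ fun k j => s j k) =
      pr fun s : Fin n → Fin n → Bool => HasNearDependence δ s :=
  avg_comp_equiv (Equiv.piComm fun _ _ : Fin n => Bool) fun s =>
    @ite ℝ (HasNearDependence δ s) (Classical.propDecidable _) 1 0

end Asymptotics

end BernoulliMatrix

/-- **Tao–Vu condition number theorem.** Let `Mₙ` be the `n × n` random matrix with
i.i.d. uniform `±1` entries (modeled by a uniform `s : Fin n → Fin n → Bool`).  For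
every `A > 0` there is `B > 0` such that for all sufficiently large `n`, the
probability that `Mₙ` is singular or its condition number `‖Mₙ‖ · ‖Mₙ⁻¹‖` is at least
`n ^ B` is at most `n ^ (-A)`. -/
theorem condition_number_bernoulli (A : ℝ) (hA : 0 < A) :
    ∃ B : ℝ, 0 < B ∧ ∃ N : ℕ, ∀ n : ℕ, N ≤ n →
      (Nat.card {s : Fin n → Fin n → Bool //
          (Matrix.of fun i j => if s i j then (1 : ℝ) else -1).det = 0 ∨
          (n : ℝ) ^ B ≤ specNorm (Matrix.of fun i j => if s i j then (1 : ℝ) else -1) *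
            specNorm (Matrix.of fun i j => if s i j then (1 : ℝ) else -1)⁻¹} : ℝ)
        / 2 ^ (n * n) ≤ (n : ℝ) ^ (-A) := by
  obtain ⟨k, hk⟩ := exists_nat_ge A
  obtain ⟨N, hN⟩ := Filter.eventually_atTop.1
    (BernoulliMatrix.eventually_pr_hasNearDependence_le k)
  refine ⟨(k + 5 : ℕ), by positivity, max N 2, fun n hn => ?_⟩
  have hn2 : 2 ≤ n := (le_max_right _ _).trans hn
  have hcard : (2 : ℝ) ^ (n * n) = Fintype.card (Fin n → Fin n → Bool) := by
    simp [pow_mul]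
  rw [hcard, ← BernoulliMatrix.pr_eq_card_div, Real.rpow_natCast]
  have hk' : 1 / (n : ℝ) ^ k ≤ (n : ℝ) ^ (-A) := by
    have hn1 : (1 : ℝ) ≤ n := by exact_mod_cast one_le_two.trans hn2
    rw [one_div, ← Real.rpow_natCast, ← Real.rpow_neg (Nat.cast_nonneg n)]
    exact Real.rpow_le_rpow_of_exponent_le hn1 (neg_le_neg hk)
  refine le_trans ?_ ((hN n ((le_max_left _ _).trans hn)).trans hk')
  rw [← BernoulliMatrix.pr_hasNearDependence_swap]
  exact BernoulliMatrix.pr_mono fun s hs =>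
    BernoulliMatrix.hasNearDependence_of_det_eq_zero_or_le k hn2 rfl hs
end
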